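/- Set L̂ = MD. For every k ≥ 1 and every Q in the unital subalgebra of End(V^{⊗k}) generated by R₁, …, R_{k−1}, there exist elements Q⁽ⁿ⁾ (for n = 1, …, k−1) of the unital subalgebras of End(V^{⊗(k−n)}) generated by R₁, …, R_{k−n−1} such that Tr_{R(1…k)}(Q · M_{⟨1→k⟩} D_{⟨k→1⟩} ∏_{s=1}^{k} J_s⁻¹) = Tr_{R(1…k)}(Q · L̂_{⟨1→k⟩}) + Σ_{n=1}^{k−1} Tr_{R(1…(k−n))}(Q⁽ⁿ⁾ · L̂_{⟨1→(k−n)⟩}). In other words, the normally ordered form :C_Q^{(k)}(L̂): of any generalized Casimir operator is a finite sum of generalized Casimir operators, and hence again belongs to the characteristic subalgebra of the algebra generated by the entries of L̂ (so it is a central quantum differential operator). -/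

import Mathlib

open scoped BigOperators

noncomputable section

/-- One-site embedding of an `N×N` matrix into `Mat_{N^k}` at 0-based position `i`
(the paper's `X_{i+1}` in 1-based numbering).  Out of range we return the identity. -/
def matAt {α : Type*} [Semiring α] (N k : ℕ) (X : Matrix (Fin N) (Fin N) α) (i : ℕ) :
    Matrix (Fin k → Fin N) (Fin k → Fin N) α :=
  if h : i < k then
    Matrix.of fun a b =>
      if ∀ l : Fin k, (l : ℕ) ≠ i → a l = b l then X (a ⟨i, h⟩) (b ⟨i, h⟩) else 0
  else 1

/-- Two-site embedding of an operator on `V⊗V` into `Mat_{N^k}` at 0-based positions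
`i, i+1` (the paper's `R_{i+1}` in 1-based numbering). -/
def opAt {α : Type*} [Semiring α] (N k : ℕ)
    (R : Matrix (Fin N × Fin N) (Fin N × Fin N) α) (i : ℕ) :
    Matrix (Fin k → Fin N) (Fin k → Fin N) α :=
  if h : i + 1 < k then
    Matrix.of fun a b =>
      if ∀ l : Fin k, (l : ℕ) ≠ i → (l : ℕ) ≠ i + 1 → a l = b l then
        R (a ⟨i, by omega⟩, a ⟨i + 1, h⟩) (b ⟨i, by omega⟩, b ⟨i + 1, h⟩)
      else 0
  else 1

/-- A numeric (complex) matrix viewed inside `Mat(A)` via the unit of `A`. -/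
def toA (A : Type*) [Semiring A] [Algebra ℂ A] {ι : Type*} (X : Matrix ι ι ℂ) :
    Matrix ι ι A :=
  X.map (algebraMap ℂ A)

/-- The braid relation `R₁R₂R₁ = R₂R₁R₂` on `V^{⊗3}`. -/
def IsBraid (N : ℕ) (R : Matrix (Fin N × Fin N) (Fin N × Fin N) ℂ) : Prop :=
  opAt N 3 R 0 * opAt N 3 R 1 * opAt N 3 R 0 = opAt N 3 R 1 * opAt N 3 R 0 * opAt N 3 R 1

/-- The Hecke condition `(q·I − R)(q⁻¹·I + R) = 0`. -/
def IsHecke (N : ℕ) (q : ℂ) (R : Matrix (Fin N × Fin N) (Fin N × Fin N) ℂ) : Prop :=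
  (q • (1 : Matrix (Fin N × Fin N) (Fin N × Fin N) ℂ) - R) * (q⁻¹ • 1 + R) = 0

/-- `q` is generic: `q ∉ {0, 1, −1}` and `qⁿ ≠ 1` for all positive integers `n`. -/
def GenericQ (q : ℂ) : Prop :=
  q ≠ 0 ∧ q ≠ 1 ∧ q ≠ -1 ∧ ∀ n : ℕ, 0 < n → q ^ n ≠ 1

/-- The reflection-equation type relation `R X₁ R X₁ = X₁ R X₁ R` in `Mat_{N²}`. -/
def RErel {α : Type*} [Semiring α] (N : ℕ)
    (R : Matrix (Fin N × Fin N) (Fin N × Fin N) α) (X : Matrix (Fin N) (Fin N) α) : Prop :=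
  opAt N 2 R 0 * matAt N 2 X 0 * opAt N 2 R 0 * matAt N 2 X 0 =
    matAt N 2 X 0 * opAt N 2 R 0 * matAt N 2 X 0 * opAt N 2 R 0

/-- The quantum-double permutation relation `D₁ R M₁ R = R M₁ R⁻¹ D₁ + R` in `Mat_{N²}(A)`. -/
def PermRel {A : Type*} [Ring A] [Algebra ℂ A] (N : ℕ)
    (R Rinv : Matrix (Fin N × Fin N) (Fin N × Fin N) ℂ)
    (M D : Matrix (Fin N) (Fin N) A) : Prop :=
  matAt N 2 D 0 * opAt N 2 (toA A R) 0 * matAt N 2 M 0 * opAt N 2 (toA A R) 0 =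
    opAt N 2 (toA A R) 0 * matAt N 2 M 0 * opAt N 2 (toA A Rinv) 0 * matAt N 2 D 0 +
      opAt N 2 (toA A R) 0

/-- The homogeneous permutation relation `D₁ R M₁ R = R M₁ R⁻¹ D₁` in `Mat_{N²}(A)`. -/
def PermRelHom {A : Type*} [Ring A] [Algebra ℂ A] (N : ℕ)
    (R Rinv : Matrix (Fin N × Fin N) (Fin N × Fin N) ℂ)
    (M D : Matrix (Fin N) (Fin N) A) : Prop :=
  matAt N 2 D 0 * opAt N 2 (toA A R) 0 * matAt N 2 M 0 * opAt N 2 (toA A R) 0 =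
    opAt N 2 (toA A R) 0 * matAt N 2 M 0 * opAt N 2 (toA A Rinv) 0 * matAt N 2 D 0

/-- Overline copies: `ovCopy … r = X_{⟨r+1⟩}`, i.e. `X_{⟨1⟩} = X⊗I⊗⋯⊗I` and
`X_{⟨r+1⟩} = R_r X_{⟨r⟩} R_r⁻¹`. -/
def ovCopy {α : Type*} [Semiring α] (N k : ℕ)
    (R Rinv : Matrix (Fin N × Fin N) (Fin N × Fin N) α)
    (X : Matrix (Fin N) (Fin N) α) : ℕ → Matrix (Fin k → Fin N) (Fin k → Fin N) α
  | 0 => matAt N k X 0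
  | r + 1 => opAt N k R r * ovCopy N k R Rinv X r * opAt N k Rinv r

/-- Underline copies: `unCopy … r = X_{[r+1]}`, i.e. `X_{[1]} = X⊗I⊗⋯⊗I` and
`X_{[r+1]} = R_r⁻¹ X_{[r]} R_r`. -/
def unCopy {α : Type*} [Semiring α] (N k : ℕ)
    (R Rinv : Matrix (Fin N × Fin N) (Fin N × Fin N) α)
    (X : Matrix (Fin N) (Fin N) α) : ℕ → Matrix (Fin k → Fin N) (Fin k → Fin N) α
  | 0 => matAt N k X 0
  | r + 1 => opAt N k Rinv r * unCopy N k R Rinv X r * opAt N k R r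

/-- `X_{⟨1→n⟩} = X_{⟨1⟩}X_{⟨2⟩}⋯X_{⟨n⟩}`. -/
def ovProd {α : Type*} [Semiring α] (N k : ℕ)
    (R Rinv : Matrix (Fin N × Fin N) (Fin N × Fin N) α)
    (X : Matrix (Fin N) (Fin N) α) (n : ℕ) : Matrix (Fin k → Fin N) (Fin k → Fin N) α :=
  ((List.range n).map (ovCopy N k R Rinv X)).prod

/-- `X_{⟨n→1⟩} = X_{⟨n⟩}X_{⟨n−1⟩}⋯X_{⟨1⟩}`. -/
def ovProdRev {α : Type*} [Semiring α] (N k : ℕ)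
    (R Rinv : Matrix (Fin N × Fin N) (Fin N × Fin N) α)
    (X : Matrix (Fin N) (Fin N) α) (n : ℕ) : Matrix (Fin k → Fin N) (Fin k → Fin N) α :=
  ((List.range n).reverse.map (ovCopy N k R Rinv X)).prod

/-- Shifted Jucys–Murphy matrices: `JMup … R n s = J_{s+1}^{↑n}`, i.e. `J₁^{↑n} = I` and
`J_{s+1}^{↑n} = R_{n+s} J_s^{↑n} R_{n+s}` (paper's 1-based `R_{n+s}` is `opAt … (n+s-1)`).
Applying it to `R⁻¹` produces `(J_{s+1}^{↑n})⁻¹`. -/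
def JMup {α : Type*} [Semiring α] (N k : ℕ)
    (R : Matrix (Fin N × Fin N) (Fin N × Fin N) α) (n : ℕ) :
    ℕ → Matrix (Fin k → Fin N) (Fin k → Fin N) α
  | 0 => 1
  | s + 1 => opAt N k R (n + s) * JMup N k R n s * opAt N k R (n + s)

/-- The quantum trace `Tr_{R(1…n)}(X) = Tr(C₁C₂⋯C_n X)`. -/
def qTr {α : Type*} [Semiring α] (N n : ℕ) (C : Matrix (Fin N) (Fin N) α)
    (X : Matrix (Fin n → Fin N) (Fin n → Fin N) α) : α :=
  Matrix.trace (((List.range n).map (matAt N n C)).prod * X)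

/-- The matrix `C`, `C_i^j = Σ_k Ψ_{ik}^{jk}`. -/
def traceMat (N : ℕ) (Ψ : Matrix (Fin N × Fin N) (Fin N × Fin N) ℂ) :
    Matrix (Fin N) (Fin N) ℂ :=
  Matrix.of fun i j => ∑ k, Ψ (i, k) (j, k)

/-- Skew-invertibility of `R`: `Tr₂(R₁₂Ψ₂₃) = Tr₂(Ψ₁₂R₂₃) = P₁₃`, written componentwise. -/
def SkewInv (N : ℕ) (R Ψ : Matrix (Fin N × Fin N) (Fin N × Fin N) ℂ) : Prop :=
  (∀ i k l n : Fin N, ∑ j, ∑ b, R (i, j) (l, b) * Ψ (b, k) (j, n) =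
      if i = n ∧ k = l then 1 else 0) ∧
  (∀ i k l n : Fin N, ∑ j, ∑ b, Ψ (i, j) (l, b) * R (b, k) (j, n) =
      if i = n ∧ k = l then 1 else 0)

/-- The generators `R₁, …, R_{n−1}` (1-based) of the Hecke-algebra image inside
`End(V^{⊗k})`, as a subset of `Mat_{N^k}`. -/
def genSet {α : Type*} [Semiring α] (N k n : ℕ)
    (R : Matrix (Fin N × Fin N) (Fin N × Fin N) α) :
    Set (Matrix (Fin k → Fin N) (Fin k → Fin N) α) :=
  {X | ∃ i : ℕ, i + 1 < n ∧ X = opAt N k R i}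

/-- The left ideal of `A` generated by the entries of `D`. -/
def entryIdeal (A : Type*) [Ring A] {N : ℕ} (D : Matrix (Fin N) (Fin N) A) :
    Submodule A A :=
  Submodule.span A {x : A | ∃ i j : Fin N, x = D i j}

/-- The normally ordered monomial `:L̂_{⟨1→k⟩}: = M_{⟨1→k⟩} D_{⟨k→1⟩} ∏_{s=1}^{k} J_s⁻¹`. -/
def normOrd {α : Type*} [Semiring α] (N k : ℕ)
    (R Rinv : Matrix (Fin N × Fin N) (Fin N × Fin N) α)
    (M D : Matrix (Fin N) (Fin N) α) (n : ℕ) :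
    Matrix (Fin k → Fin N) (Fin k → Fin N) α :=
  ovProd N k R Rinv M n * ovProdRev N k R Rinv D n *
    ((List.range n).map (fun s => JMup N k Rinv 0 s)).prod


/-! ### The abstract braid and Hecke computations -/

section ProdSeq

variable {B : Type*} [Ring B]

/-- `copySeq r r' x n` is the overline copy `x_{⟨n+1⟩}`. -/
def copySeq (r r' : ℕ → B) (x : B) : ℕ → B
  | 0 => x
  | n + 1 => r n * copySeq r r' x n * r' n

/-- The inverse Jucys–Murphy elements `J_{n+1}⁻¹`. -/
def jmInv (r' : ℕ → B) : ℕ → B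
  | 0 => 1
  | n + 1 => r' n * jmInv r' n * r' n

/-- `prodSeq f n = f 0 * ⋯ * f (n - 1)`. -/
def prodSeq (f : ℕ → B) (n : ℕ) : B := ((List.range n).map f).prod

/-- `prodSeqRev f n = f (n - 1) * ⋯ * f 0`. -/
def prodSeqRev (f : ℕ → B) (n : ℕ) : B :=
  ((List.range n).reverse.map f).prod

theorem prodSeq_zero (f : ℕ → B) : prodSeq f 0 = 1 := by simp [prodSeq]

theorem prodSeq_succ (f : ℕ → B) (n : ℕ) : prodSeq f (n + 1) = prodSeq f n * f n := by
  simp [prodSeq, List.range_succ]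

theorem prodSeqRev_zero (f : ℕ → B) : prodSeqRev f 0 = 1 := by simp [prodSeqRev]

theorem prodSeqRev_succ (f : ℕ → B) (n : ℕ) :
    prodSeqRev f (n + 1) = f n * prodSeqRev f n := by
  simp [prodSeqRev, List.range_succ]

theorem commute_prodSeq {f : ℕ → B} {x : B} {n : ℕ} (h : ∀ i, i < n → Commute x (f i)) :
    Commute x (prodSeq f n) := by
  induction n with
  | zero => rw [prodSeq_zero]; exact Commute.one_right x
  | succ n ih =>
    rw [prodSeq_succ]
    exact (ih fun i hi => h i (by omega)).mul_right (h n (by omega))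

theorem commute_prodSeqRev {f : ℕ → B} {x : B} {n : ℕ} (h : ∀ i, i < n → Commute x (f i)) :
    Commute x (prodSeqRev f n) := by
  induction n with
  | zero => rw [prodSeqRev_zero]; exact Commute.one_right x
  | succ n ih =>
    rw [prodSeqRev_succ]
    exact (h n (by omega)).mul_right (ih fun i hi => h i (by omega))

theorem conj_mul_conj {g g' : B} (h : g' * g = 1) (x y : B) :
    g * x * g' * (g * y * g') = g * (x * y) * g' := by
  have : g * x * g' * (g * y * g') = g * x * (g' * g) * y * g' := by simp only [mul_assoc]
  rw [this, h, mul_one, mul_assoc g x y]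

end ProdSeq

/-- Elements `r i` (`i + 1 < k`) of an algebra satisfying the braid and Hecke relations, with
inverses `r' i`. -/
structure HeckeSystem {B : Type*} [Ring B] [Algebra ℂ B] (k : ℕ) (lam : ℂ) (r r' : ℕ → B) :
    Prop where
  mul_inv : ∀ i, r i * r' i = 1
  inv_mul : ∀ i, r' i * r i = 1
  far : ∀ i j, i + 2 ≤ j → Commute (r i) (r j)
  braid : ∀ i, i + 2 < k → r i * r (i + 1) * r i = r (i + 1) * r i * r (i + 1)
  hecke : ∀ i, i + 1 < k → r i = r' i + algebraMap ℂ B lam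

/-- The subalgebra generated by the first `n - 1` generators. -/
def heckeSub {B : Type*} [Ring B] [Algebra ℂ B] (r : ℕ → B) (n : ℕ) : Subalgebra ℂ B :=
  Algebra.adjoin ℂ {x | ∃ i : ℕ, i + 1 < n ∧ x = r i}

section HeckeSub

variable {B : Type*} [Ring B] [Algebra ℂ B] {k : ℕ} {lam : ℂ} {r r' : ℕ → B}

theorem gen_mem_heckeSub {n i : ℕ} (h : i + 1 < n) : r i ∈ heckeSub r n :=
  Algebra.subset_adjoin ⟨i, h, rfl⟩

theorem heckeSub_mono {m n : ℕ} (h : m ≤ n) : heckeSub r m ≤ heckeSub r n :=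
  Algebra.adjoin_mono fun _ ⟨i, hi, hx⟩ => ⟨i, by omega, hx⟩

theorem commute_of_mem_heckeSub {n : ℕ} {y x : B} (hy : ∀ i, i + 1 < n → Commute (r i) y)
    (hx : x ∈ heckeSub r n) : Commute x y := by
  induction hx using Algebra.adjoin_induction with
  | mem x h => obtain ⟨i, hi, rfl⟩ := h; exact hy i hi
  | algebraMap c => exact Algebra.commutes c y
  | add a b _ _ ha hb => exact ha.add_left hb
  | mul a b _ _ ha hb => exact ha.mul_left hb

namespace HeckeSystem

theorem inv_mem (S : HeckeSystem k lam r r') {n i : ℕ} (h : i + 1 < n) (hn : n ≤ k) :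
    r' i ∈ heckeSub r n := by
  have : r' i = r i - algebraMap ℂ B lam := by rw [S.hecke i (by omega)]; abel
  rw [this]
  exact sub_mem (gen_mem_heckeSub h) (Subalgebra.algebraMap_mem _ _)

theorem sq (S : HeckeSystem k lam r r') {i : ℕ} (h : i + 1 < k) :
    r i * r i = 1 + lam • r i := by
  nth_rewrite 2 [S.hecke i h]
  rw [mul_add, S.mul_inv, ← Algebra.commutes, Algebra.smul_def]

theorem commute_inv (S : HeckeSystem k lam r r') {i : ℕ} {y : B} (h : Commute (r i) y) :
    Commute (r' i) y :=
  calc r' i * y = r' i * (y * r i) * r' i := by simp only [mul_assoc, S.mul_inv, mul_one]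
    _ = y * r' i := by rw [← h.eq, ← mul_assoc, S.inv_mul, one_mul]

theorem braid_inv_right (S : HeckeSystem k lam r r') {i : ℕ} (h : i + 2 < k) :
    r (i + 1) * r' i * r' (i + 1) = r' i * r' (i + 1) * r i :=
  calc r (i + 1) * r' i * r' (i + 1)
      = r' i * r' (i + 1) * (r (i + 1) * r i * r (i + 1)) * r' i * r' (i + 1) := by
        rw [← mul_assoc, ← mul_assoc, mul_assoc (r' i), S.inv_mul, mul_one, S.inv_mul, one_mul]
    _ = r' i * r' (i + 1) * r i * (r (i + 1) * (r i * r' i) * r' (i + 1)) := by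
        rw [← S.braid i h]; simp only [mul_assoc]
    _ = r' i * r' (i + 1) * r i := by rw [S.mul_inv, mul_one, S.mul_inv, mul_one]

theorem braid_inv_left (S : HeckeSystem k lam r r') {i : ℕ} (h : i + 2 < k) :
    r i * r' (i + 1) * r' i = r' (i + 1) * r' i * r (i + 1) :=
  calc r i * r' (i + 1) * r' i
      = r' (i + 1) * r' i * (r i * r (i + 1) * r i) * r' (i + 1) * r' i := by
        rw [← mul_assoc, ← mul_assoc, mul_assoc (r' (i + 1)), S.inv_mul, mul_one, S.inv_mul,
          one_mul]
    _ = r' (i + 1) * r' i * r (i + 1) * (r i * (r (i + 1) * r' (i + 1)) * r' i) := by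
        rw [S.braid i h]; simp only [mul_assoc]
    _ = r' (i + 1) * r' i * r (i + 1) := by rw [S.mul_inv, mul_one, S.mul_inv, mul_one]

theorem gen_mul_cancel (S : HeckeSystem k lam r r') (n : ℕ) :
    r' (n + 1) * r' n * (r n * r (n + 1)) = 1 := by
  rw [mul_assoc, ← mul_assoc (r' n), S.inv_mul, one_mul, S.inv_mul]

theorem commute_copySeq_of_lt (S : HeckeSystem k lam r r') {x : B}
    (hx : ∀ i, 1 ≤ i → Commute (r i) x) {n j : ℕ} (h : n < j) :
    Commute (r j) (copySeq r r' x n) := by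
  induction n with
  | zero => exact hx j h
  | succ n ih =>
    have h1 : Commute (r j) (r n) := (S.far n j (by omega)).symm
    exact (h1.mul_right (ih (by omega))).mul_right (S.commute_inv h1.symm).symm

theorem commute_copySeq_of_gt (S : HeckeSystem k lam r r') {x : B}
    (hx : ∀ i, 1 ≤ i → Commute (r i) x) {n j : ℕ} (h : j + 1 < n) (hn : n < k) :
    Commute (r j) (copySeq r r' x n) := by
  induction n with
  | zero => omega
  | succ n ih =>
    rcases Nat.lt_or_ge (j + 1) n with hj | hj
    · have h1 : Commute (r j) (r n) := S.far j n (by omega)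
      exact (h1.mul_right (ih hj (by omega))).mul_right (S.commute_inv h1.symm).symm
    · obtain rfl : n = j + 1 := by omega
      have hY := (S.commute_copySeq_of_lt hx (Nat.lt_succ_self j)).eq
      simp only [copySeq]
      generalize copySeq r r' x j = Y at hY
      calc r j * (r (j + 1) * (r j * Y * r' j) * r' (j + 1))
          = r j * r (j + 1) * r j * Y * r' j * r' (j + 1) := by simp only [mul_assoc]
        _ = r (j + 1) * r j * (r (j + 1) * Y) * r' j * r' (j + 1) := by
            rw [S.braid j (by omega)]; simp only [mul_assoc]
        _ = r (j + 1) * r j * Y * (r (j + 1) * r' j * r' (j + 1)) := by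
            rw [hY]; simp only [mul_assoc]
        _ = r (j + 1) * (r j * Y * r' j) * r' (j + 1) * r j := by
            rw [S.braid_inv_right (by omega)]; simp only [mul_assoc]

theorem commute_jmInv_of_lt (S : HeckeSystem k lam r r') {n j : ℕ} (h : n < j) :
    Commute (r j) (jmInv r' n) := by
  induction n with
  | zero => exact Commute.one_right _
  | succ n ih =>
    have h1 : Commute (r j) (r' n) := (S.commute_inv (S.far n j (by omega))).symm
    exact (h1.mul_right (ih (by omega))).mul_right h1

theorem commute_jmInv_of_gt (S : HeckeSystem k lam r r') {n j : ℕ} (h : j + 1 < n)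
    (hn : n < k) : Commute (r j) (jmInv r' n) := by
  induction n with
  | zero => omega
  | succ n ih =>
    rcases Nat.lt_or_ge (j + 1) n with hj | hj
    · have h1 : Commute (r j) (r' n) := (S.commute_inv (S.far j n (by omega)).symm).symm
      exact (h1.mul_right (ih hj (by omega))).mul_right h1
    · obtain rfl : n = j + 1 := by omega
      have hY := (S.commute_jmInv_of_lt (Nat.lt_succ_self j)).eq
      simp only [jmInv]
      generalize jmInv r' j = Y at hY
      calc r j * (r' (j + 1) * (r' j * Y * r' j) * r' (j + 1))
          = r j * r' (j + 1) * r' j * Y * r' j * r' (j + 1) := by simp only [mul_assoc]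
        _ = r' (j + 1) * r' j * (r (j + 1) * Y) * r' j * r' (j + 1) := by
            rw [S.braid_inv_left (by omega)]; simp only [mul_assoc]
        _ = r' (j + 1) * r' j * Y * (r (j + 1) * r' j * r' (j + 1)) := by
            rw [hY]; simp only [mul_assoc]
        _ = r' (j + 1) * (r' j * Y * r' j) * r' (j + 1) * r j := by
            rw [S.braid_inv_right (by omega)]; simp only [mul_assoc]

theorem jmInv_mem (S : HeckeSystem k lam r r') {n : ℕ} (hn : n < k) :
    jmInv r' n ∈ heckeSub r (n + 1) := by
  induction n with
  | zero => exact one_mem _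
  | succ n ih =>
    have h1 : r' n ∈ heckeSub r (n + 1 + 1) := S.inv_mem (by omega) (by omega)
    exact mul_mem (mul_mem h1 (heckeSub_mono (by omega) (ih (by omega)))) h1

theorem prodSeq_jmInv_mem (S : HeckeSystem k lam r r') {n : ℕ} (hn : n ≤ k) :
    prodSeq (jmInv r') n ∈ heckeSub r n := by
  induction n with
  | zero => rw [prodSeq_zero]; exact one_mem _
  | succ n ih =>
    rw [prodSeq_succ]
    exact mul_mem (heckeSub_mono (by omega) (ih (by omega))) (S.jmInv_mem (by omega))

/-- Conjugation by `r n * r (n + 1)` shifts `r n` to `r (n + 1)`. -/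
theorem conj_gen (S : HeckeSystem k lam r r') {n : ℕ} (h : n + 2 < k) :
    r (n + 1) = r n * r (n + 1) * r n * (r' (n + 1) * r' n) := by
  rw [S.braid n h, mul_assoc, ← mul_assoc (r (n + 1)) (r' (n + 1)), S.mul_inv, one_mul,
    mul_assoc, S.mul_inv, mul_one]

theorem conj_gen_inv (S : HeckeSystem k lam r r') {n : ℕ} (h : n + 2 < k) :
    r' (n + 1) = r n * r (n + 1) * r' n * (r' (n + 1) * r' n) := by
  have h1 : r n * r (n + 1) * r' n * (r' (n + 1) * r' n) =
      r n * (r (n + 1) * r' n * r' (n + 1)) * r' n := by simp only [mul_assoc]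
  rw [h1, S.braid_inv_right h, mul_assoc, mul_assoc, S.mul_inv, mul_one, ← mul_assoc,
    S.mul_inv, one_mul]

theorem conj_copySeq (S : HeckeSystem k lam r r') {x : B}
    (hx : ∀ i, 1 ≤ i → Commute (r i) x) (n : ℕ) :
    copySeq r r' x (n + 1) =
      r n * r (n + 1) * copySeq r r' x n * (r' (n + 1) * r' n) := by
  have h := (S.commute_copySeq_of_lt hx (Nat.lt_succ_self n)).eq
  rw [mul_assoc (r n), h, copySeq]
  have : copySeq r r' x n * r (n + 1) * (r' (n + 1) * r' n) =
      copySeq r r' x n * (r (n + 1) * r' (n + 1)) * r' n := by simp only [mul_assoc]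
  rw [mul_assoc (r n) _ (r' (n + 1) * r' n), this, S.mul_inv, mul_one, mul_assoc]

end HeckeSystem

/-- The abstract form of the quantum-double data: `m` and `d` sit on the first site. -/
structure DoubleSystem {B : Type*} [Ring B] [Algebra ℂ B] (k : ℕ) (lam : ℂ) (r r' : ℕ → B)
    (m d : B) : Prop extends HeckeSystem k lam r r' where
  comm_m : ∀ i, 1 ≤ i → Commute (r i) m
  comm_d : ∀ i, 1 ≤ i → Commute (r i) d
  perm : 1 < k → d * r 0 * m * r 0 = r 0 * m * r' 0 * d + r 0
  refl : 1 < k → r' 0 * d * r' 0 * d = d * r' 0 * d * r' 0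

namespace DoubleSystem

variable {m d : B}

theorem perm_shift (S : DoubleSystem k lam r r' m d) {n : ℕ} (h : n + 1 < k) :
    copySeq r r' d n * r n * copySeq r r' m n * r n =
      r n * copySeq r r' m n * r' n * copySeq r r' d n + r n := by
  induction n with
  | zero => exact S.perm (by omega)
  | succ n ih =>
    specialize ih (by omega)
    have hr := S.conj_gen h
    have hr' := S.conj_gen_inv h
    have hd := S.conj_copySeq S.comm_d n
    have hm := S.conj_copySeq S.comm_m n
    have hg := S.gen_mul_cancel n
    generalize r n * r (n + 1) = g at *
    generalize r' (n + 1) * r' n = g' at *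
    rw [hd, hm, hr', hr]
    simp only [conj_mul_conj hg, ih, mul_add, add_mul]

theorem refl_shift (S : DoubleSystem k lam r r' m d) {n : ℕ} (h : n + 1 < k) :
    r' n * copySeq r r' d n * r' n * copySeq r r' d n =
      copySeq r r' d n * r' n * copySeq r r' d n * r' n := by
  induction n with
  | zero => exact S.refl (by omega)
  | succ n ih =>
    specialize ih (by omega)
    have hr' := S.conj_gen_inv h
    have hd := S.conj_copySeq S.comm_d n
    have hg := S.gen_mul_cancel n
    generalize r n * r (n + 1) = g at *
    generalize r' (n + 1) * r' n = g' at *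
    rw [hd, hr']
    simp only [conj_mul_conj hg, ih]

theorem perm_copy (S : DoubleSystem k lam r r' m d) {n : ℕ} (h : n + 1 < k) :
    copySeq r r' d n * r n * copySeq r r' m n =
      copySeq r r' m (n + 1) * copySeq r r' d n * r' n + 1 := by
  have e := congrArg (· * r' n) (S.perm_shift h)
  simp only [add_mul, S.mul_inv] at e
  rwa [mul_assoc _ (r n) (r' n), S.mul_inv, mul_one] at e

theorem refl_copy (S : DoubleSystem k lam r r' m d) {n : ℕ} (h : n + 1 < k) :
    copySeq r r' d n * r' n * copySeq r r' d n =
      copySeq r r' d (n + 1) * copySeq r r' d n * r' n := by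
  have e := congrArg (r n * ·) (S.refl_shift h)
  simp only [← mul_assoc, S.mul_inv, one_mul] at e
  rw [copySeq, ← e]

/-- Moving `M_{⟨n+1⟩} D_{⟨n+1⟩}` through `D_{⟨n→1⟩}`. -/
theorem prodSeqRev_mul_copy (S : DoubleSystem k lam r r' m d) (hl : lam ≠ 0) {n : ℕ}
    (h : n < k) :
    prodSeqRev (copySeq r r' d) n * copySeq r r' m n * copySeq r r' d n =
      copySeq r r' m n * copySeq r r' d n * prodSeqRev (copySeq r r' d) n * jmInv r' n +
        prodSeqRev (copySeq r r' d) n * lam⁻¹ • (1 - jmInv r' n) := by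
  induction n with
  | zero => simp [prodSeqRev_zero, jmInv]
  | succ n ih =>
    specialize ih (by omega)
    have hp := S.perm_copy h
    have hr := S.refl_copy h
    have hcomm : Commute (r n) (prodSeqRev (copySeq r r' d) n) :=
      commute_prodSeqRev fun i hi => S.commute_copySeq_of_lt S.comm_d hi
    have hcomm' := (S.commute_inv hcomm).eq
    rw [prodSeqRev_succ]
    have hm : copySeq r r' m (n + 1) = r n * copySeq r r' m n * r' n := rfl
    have hd : copySeq r r' d (n + 1) = r n * copySeq r r' d n * r' n := rfl
    have hj : jmInv r' (n + 1) = r' n * jmInv r' n * r' n := rfl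
    generalize prodSeqRev (copySeq r r' d) n = P at *
    generalize copySeq r r' m n = mn at *
    generalize copySeq r r' d n = dn at *
    have hX : lam⁻¹ • (r n * (1 - jmInv r' n) * r' n) + jmInv r' n * r' n =
        lam⁻¹ • (1 - jmInv r' (n + 1)) := by
      rw [hj, mul_sub, sub_mul, mul_one, S.mul_inv, S.hecke n h, add_mul, add_mul, mul_assoc,
        ← Algebra.smul_def, smul_mul_assoc, smul_sub, smul_sub, smul_add, smul_smul,
        inv_mul_cancel₀ hl, one_smul]
      abel
    calc dn * P * copySeq r r' m (n + 1) * copySeq r r' d (n + 1)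
        = dn * (P * r n) * mn * (r' n * r n) * dn * r' n := by
          rw [hm, hd]; simp only [mul_assoc]
      _ = dn * r n * (P * mn * dn) * r' n := by
          rw [S.inv_mul, mul_one, ← hcomm.eq]; simp only [mul_assoc]
      _ = dn * r n * mn * (dn * P * jmInv r' n * r' n) +
            dn * (r n * P) * (lam⁻¹ • (1 - jmInv r' n)) * r' n := by
          rw [ih, mul_add, add_mul]; simp only [mul_assoc]
      _ = copySeq r r' m (n + 1) * (dn * r' n * dn) * P * jmInv r' n * r' n +
            (dn * P * (jmInv r' n * r' n) +
              dn * P * (lam⁻¹ • (r n * (1 - jmInv r' n) * r' n))) := by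
          rw [hp, add_mul, one_mul, hcomm.eq, add_assoc]
          simp only [mul_assoc, smul_mul_assoc, mul_smul_comm]
      _ = copySeq r r' m (n + 1) * copySeq r r' d (n + 1) * (dn * P) * jmInv r' (n + 1) +
            dn * P * lam⁻¹ • (1 - jmInv r' (n + 1)) := by
          rw [hr, ← mul_add, add_comm (jmInv r' n * r' n), hX, hj]
          congr 1
          calc copySeq r r' m (n + 1) * (copySeq r r' d (n + 1) * dn * r' n) * P * jmInv r' n * r' n
              = copySeq r r' m (n + 1) * copySeq r r' d (n + 1) * dn * (r' n * P) * jmInv r' n *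
                  r' n := by simp only [mul_assoc]
            _ = _ := by rw [hcomm']; simp only [mul_assoc]

theorem copySeq_mul (S : HeckeSystem k lam r r') (n : ℕ) :
    copySeq r r' (m * d) n = copySeq r r' m n * copySeq r r' d n := by
  induction n with
  | zero => rfl
  | succ n ih => rw [copySeq, copySeq, copySeq, ih, conj_mul_conj (S.inv_mul n)]

/-- The normally ordered monomial `:L̂_{⟨1→n⟩}:`. -/
theorem normal_succ (S : DoubleSystem k lam r r' m d) (hl : lam ≠ 0) {n : ℕ} (h : n < k) :
    prodSeq (copySeq r r' m) (n + 1) * prodSeqRev (copySeq r r' d) (n + 1) *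
        prodSeq (jmInv r') (n + 1) =
      prodSeq (copySeq r r' m) n * prodSeqRev (copySeq r r' d) n * prodSeq (jmInv r') n *
        (copySeq r r' (m * d) n - lam⁻¹ • (1 - jmInv r' n)) := by
  have hmd : ∀ i, 1 ≤ i → Commute (r i) (m * d) := fun i hi =>
    (S.comm_m i hi).mul_right (S.comm_d i hi)
  have hJ := S.prodSeq_jmInv_mem h.le
  have h1 := (commute_of_mem_heckeSub
    (fun i hi => S.commute_copySeq_of_gt hmd (n := n) hi h) hJ).eq
  have h2 := (commute_of_mem_heckeSub
    (fun i hi => S.commute_jmInv_of_gt (n := n) hi h) hJ).eq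
  have key := S.prodSeqRev_mul_copy hl h
  rw [copySeq_mul S.toHeckeSystem] at h1 ⊢
  rw [prodSeq_succ, prodSeqRev_succ, prodSeq_succ]
  generalize prodSeq (copySeq r r' m) n = PM at *
  generalize prodSeqRev (copySeq r r' d) n = PD at *
  generalize prodSeq (jmInv r') n = PJ at *
  generalize copySeq r r' m n = mn at *
  generalize copySeq r r' d n = dn at *
  have h3 : PJ * (lam⁻¹ • (1 - jmInv r' n)) = lam⁻¹ • (1 - jmInv r' n) * PJ := by
    rw [mul_smul_comm, smul_mul_assoc, mul_sub, sub_mul, h2, one_mul, mul_one]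
  rw [mul_assoc (PM * PD), mul_sub PJ, h1, h3, ← sub_mul, h2]
  have := congrArg (fun x => PM * x * PJ) (eq_sub_of_add_eq key.symm)
  simp only [← mul_assoc, mul_sub, sub_mul] at this ⊢
  exact this

/-- The span of `h * L̂_{⟨1→j⟩} * h'` with `1 ≤ j < n` and `h, h'` in the `n`-th Hecke
subalgebra. -/
def lowerTerms (r r' : ℕ → B) (l : B) (n : ℕ) : Submodule ℂ B :=
  Submodule.span ℂ {x | ∃ j, 1 ≤ j ∧ j < n ∧ ∃ h ∈ heckeSub r n, ∃ h' ∈ heckeSub r n,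
    x = h * prodSeq (copySeq r r' l) j * h'}

theorem prodSeq_mul_copy (S : HeckeSystem k lam r r') {l : B}
    (hl : ∀ i, 1 ≤ i → Commute (r i) l) {j n : ℕ} (hj : j ≤ n) (hn : n < k) :
    ∃ g ∈ heckeSub r (n + 1), ∃ g' ∈ heckeSub r (n + 1),
      prodSeq (copySeq r r' l) j * copySeq r r' l n =
        g * prodSeq (copySeq r r' l) (j + 1) * g' := by
  induction n with
  | zero =>
    obtain rfl : j = 0 := by omega
    exact ⟨1, one_mem _, 1, one_mem _, by rw [prodSeq_succ, one_mul, mul_one]⟩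
  | succ n ih =>
    rcases Nat.lt_or_ge n j with h | h
    · obtain rfl : j = n + 1 := by omega
      exact ⟨1, one_mem _, 1, one_mem _, by rw [← prodSeq_succ, one_mul, mul_one]⟩
    · obtain ⟨g, hg, g', hg', e⟩ := ih h (by omega)
      have hc : Commute (r n) (prodSeq (copySeq r r' l) j) :=
        commute_prodSeq fun i hi => S.commute_copySeq_of_lt hl (by omega)
      refine ⟨r n * g, mul_mem (gen_mem_heckeSub (by omega)) (heckeSub_mono (by omega) hg),
        g' * r' n, mul_mem (heckeSub_mono (by omega) hg') (S.inv_mem (by omega) (by omega)), ?_⟩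
      rw [copySeq, ← mul_assoc, ← mul_assoc, ← hc.eq, mul_assoc (r n), e]
      simp only [mul_assoc]

theorem normal_sub_mem (S : DoubleSystem k lam r r' m d) (hl : lam ≠ 0) {n : ℕ} (h1 : 1 ≤ n)
    (h : n ≤ k) :
    prodSeq (copySeq r r' m) n * prodSeqRev (copySeq r r' d) n * prodSeq (jmInv r') n -
      prodSeq (copySeq r r' (m * d)) n ∈ lowerTerms r r' (m * d) n := by
  have hmd : ∀ i, 1 ≤ i → Commute (r i) (m * d) := fun i hi =>
    (S.comm_m i hi).mul_right (S.comm_d i hi)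
  induction n, h1 using Nat.le_induction with
  | base => simp [prodSeq, prodSeqRev, copySeq, jmInv, zero_mem]
  | succ n hn ih =>
    specialize ih (by omega)
    rw [S.normal_succ hl (by omega), prodSeq_succ]
    generalize prodSeq (copySeq r r' m) n * prodSeqRev (copySeq r r' d) n *
      prodSeq (jmInv r') n = P at *
    set X := lam⁻¹ • (1 - jmInv r' n) with hX
    have hXm : X ∈ heckeSub r (n + 1) :=
      Subalgebra.smul_mem _ (sub_mem (one_mem _) (S.jmInv_mem (by omega))) _
    have e : P * (copySeq r r' (m * d) n - X) -
        prodSeq (copySeq r r' (m * d)) n * copySeq r r' (m * d) n =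
        (P - prodSeq (copySeq r r' (m * d)) n) * (copySeq r r' (m * d) n - X) -
          prodSeq (copySeq r r' (m * d)) n * X := by noncomm_ring
    rw [e]
    refine sub_mem ?_ (Submodule.subset_span ⟨n, hn, by omega, 1, one_mem _, X, hXm,
      by rw [one_mul]⟩)
    refine Submodule.span_induction (p := fun x _ => x * (copySeq r r' (m * d) n - X) ∈
      lowerTerms r r' (m * d) (n + 1)) ?_ ?_ ?_ ?_ ih
    · rintro _ ⟨j, hj, hjn, a, ha, a', ha', rfl⟩
      have hc := (commute_of_mem_heckeSub
        (fun i hi => S.commute_copySeq_of_gt hmd (n := n) hi (by omega)) ha').eq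
      obtain ⟨g, hg, g', hg', e⟩ := prodSeq_mul_copy S.toHeckeSystem hmd hjn.le (by omega)
      have mono : heckeSub r n ≤ heckeSub r (n + 1) := heckeSub_mono (by omega)
      rw [mul_sub, mul_assoc _ a', hc]
      refine sub_mem (Submodule.subset_span ⟨j + 1, by omega, by omega, a * g,
        mul_mem (mono ha) hg, g' * a', mul_mem hg' (mono ha'), ?_⟩)
        (Submodule.subset_span ⟨j, hj, by omega, a, mono ha, a' * X, mul_mem (mono ha') hXm, ?_⟩)
      · rw [← mul_assoc, mul_assoc a, e]; simp only [mul_assoc]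
      · simp only [mul_assoc]
    · rw [zero_mul]; exact zero_mem _
    · intro x y _ _ hx hy; rw [add_mul]; exact add_mem hx hy
    · intro c x _ hx; rw [smul_mul_assoc]; exact Submodule.smul_mem _ c hx

end DoubleSystem

/-- A spanning set for `H_{n+2}`: `H_{n+2} = H_{n+1} + H_{n+1} R_{n+1} H_{n+1}`. -/
def heckeSpan (r : ℕ → B) (n : ℕ) : Submodule ℂ B :=
  Submodule.span ℂ ((heckeSub r (n + 1) : Set B) ∪
      {x | ∃ y ∈ heckeSub r (n + 1), ∃ z ∈ heckeSub r (n + 1), x = y * r n * z})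

theorem mem_heckeSpan_of_mem {n : ℕ} {x : B} (hx : x ∈ heckeSub r (n + 1)) :
    x ∈ heckeSpan r n := Submodule.subset_span (Or.inl hx)

theorem mul_gen_mul_mem_heckeSpan {n : ℕ} {y z : B} (hy : y ∈ heckeSub r (n + 1))
    (hz : z ∈ heckeSub r (n + 1)) : y * r n * z ∈ heckeSpan r n :=
  Submodule.subset_span (Or.inr ⟨y, hy, z, hz, rfl⟩)

namespace HeckeSystem

theorem mul_gen_mul_gen_mem (S : HeckeSystem k lam r r') {n : ℕ} (hn : n + 1 < k) {y z : B}
    (hy : y ∈ heckeSub r (n + 1)) (hz : z ∈ heckeSub r (n + 1)) :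
    y * r n * r n * z ∈ heckeSpan r n := by
  rw [mul_assoc y, S.sq hn, mul_add, add_mul, mul_one, mul_smul_comm, smul_mul_assoc]
  exact add_mem (mem_heckeSpan_of_mem (mul_mem hy hz))
    (Submodule.smul_mem _ _ (mul_gen_mul_mem_heckeSpan hy hz))

theorem mem_heckeSpan_of_gen_mul_gen {n : ℕ}
    (H : ∀ y ∈ heckeSub r (n + 1), ∀ z ∈ heckeSub r (n + 1),
      y * r n * z * r n ∈ heckeSpan r n) {x : B} (hx : x ∈ heckeSub r (n + 2)) :
    x ∈ heckeSpan r n := by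
  suffices ∀ e ∈ heckeSpan r n, e * x ∈ heckeSpan r n by
    simpa using this 1 (mem_heckeSpan_of_mem (one_mem _))
  induction hx using Algebra.adjoin_induction with
  | mem x h =>
    obtain ⟨i, hi, rfl⟩ := h
    intro e he
    refine Submodule.span_induction (p := fun e _ => e * r i ∈ heckeSpan r n) ?_ ?_ ?_ ?_ he
    · rcases Nat.lt_or_ge i n with hin | hin
      · have hr : r i ∈ heckeSub r (n + 1) := gen_mem_heckeSub (by omega)
        rintro e (he | ⟨y, hy, z, hz, rfl⟩)
        · exact mem_heckeSpan_of_mem (mul_mem he hr)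
        · rw [mul_assoc]; exact mul_gen_mul_mem_heckeSpan hy (mul_mem hz hr)
      · obtain rfl : i = n := by omega
        rintro e (he | ⟨y, hy, z, hz, rfl⟩)
        · rw [← mul_one (e * r i)]; exact mul_gen_mul_mem_heckeSpan he (one_mem _)
        · exact H y hy z hz
    · rw [zero_mul]; exact zero_mem _
    · intro a b _ _ ha hb; rw [add_mul]; exact add_mem ha hb
    · intro c a _ ha; rw [smul_mul_assoc]; exact Submodule.smul_mem _ c ha
  | algebraMap c =>
    intro e he
    rw [← Algebra.commutes, ← Algebra.smul_def]; exact Submodule.smul_mem _ c he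
  | add a b _ _ ha hb => intro e he; rw [mul_add]; exact add_mem (ha e he) (hb e he)
  | mul a b _ _ ha hb => intro e he; rw [← mul_assoc]; exact hb _ (ha e he)

theorem mem_heckeSpan (S : HeckeSystem k lam r r') {n : ℕ} (hn : n + 1 < k) {x : B}
    (hx : x ∈ heckeSub r (n + 2)) : x ∈ heckeSpan r n := by
  induction n generalizing x with
  | zero =>
    refine mem_heckeSpan_of_gen_mul_gen (fun y hy z hz => ?_) hx
    have : ∀ w : ℕ, Commute (r w) z := fun w =>
      (commute_of_mem_heckeSub (fun i hi => absurd hi (by omega)) hz).symm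
    rw [mul_assoc, ← (this 0).eq, ← mul_assoc]
    exact S.mul_gen_mul_gen_mem hn hy hz
  | succ n ih =>
    refine mem_heckeSpan_of_gen_mul_gen (fun y hy z hz => ?_) hx
    have hc : ∀ w ∈ heckeSub r (n + 1), w * r (n + 1) = r (n + 1) * w := fun w hw =>
      (commute_of_mem_heckeSub (fun i hi => S.far i (n + 1) (by omega)) hw).eq
    refine Submodule.span_induction (p := fun z _ => y * r (n + 1) * z * r (n + 1) ∈
      heckeSpan r (n + 1)) ?_ ?_ ?_ ?_ (ih (by omega) hz)
    · have mono : heckeSub r (n + 1) ≤ heckeSub r (n + 2) := heckeSub_mono (by omega)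
      rintro z (hz | ⟨u, hu, v, hv, rfl⟩)
      · rw [mul_assoc, hc z hz, ← mul_assoc]
        exact S.mul_gen_mul_gen_mem hn hy (mono hz)
      · have e : y * r (n + 1) * (u * r n * v) * r (n + 1) =
            y * u * r n * r (n + 1) * (r n * v) :=
          calc y * r (n + 1) * (u * r n * v) * r (n + 1)
              = y * (r (n + 1) * u) * r n * (v * r (n + 1)) := by simp only [mul_assoc]
            _ = y * u * (r (n + 1) * r n * r (n + 1)) * v := by
                rw [hc v hv, ← hc u hu]; simp only [mul_assoc]
            _ = y * u * r n * r (n + 1) * (r n * v) := by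
                rw [← S.braid n hn]; simp only [mul_assoc]
        have hr : r n ∈ heckeSub r (n + 1 + 1) := gen_mem_heckeSub (by omega)
        rw [e]
        exact mul_gen_mul_mem_heckeSpan (mul_mem (mul_mem hy (mono hu)) hr)
          (mul_mem hr (mono hv))
    · rw [mul_zero, zero_mul]; exact zero_mem _
    · intro a b _ _ ha hb; rw [mul_add, add_mul]; exact add_mem ha hb
    · intro c a _ ha
      rw [mul_smul_comm, smul_mul_assoc]; exact Submodule.smul_mem _ c ha

end HeckeSystem

end HeckeSub

/-! ### Embeddings of tensor factors -/

section Embedding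

variable {α : Type*} [Semiring α] {N m k : ℕ}

/-- An operator on `V^{⊗m}` acting in the tensor factors of `V^{⊗k}` selected by `f`. -/
def emb (f : Fin m → Fin k) (X : Matrix (Fin m → Fin N) (Fin m → Fin N) α) :
    Matrix (Fin k → Fin N) (Fin k → Fin N) α :=
  Matrix.of fun a b => if ∀ l, (∀ i, f i ≠ l) → a l = b l then X (a ∘ f) (b ∘ f) else 0

theorem emb_apply (f : Fin m → Fin k) (X : Matrix (Fin m → Fin N) (Fin m → Fin N) α)
    (a b : Fin k → Fin N) :
    emb f X a b = if ∀ l, (∀ i, f i ≠ l) → a l = b l then X (a ∘ f) (b ∘ f) else 0 := rfl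

theorem extend_apply_off (f : Fin m → Fin k) (c : Fin m → Fin N) (a : Fin k → Fin N) {l : Fin k}
    (h : ∀ i, f i ≠ l) : Function.extend f c a l = a l :=
  Function.extend_apply' _ _ _ fun ⟨i, hi⟩ => h i hi

theorem eq_extend {f : Fin m → Fin k} (hf : Function.Injective f) {a c : Fin k → Fin N}
    (h : ∀ l, (∀ i, f i ≠ l) → a l = c l) : Function.extend f (c ∘ f) a = c := by
  funext l
  by_cases hl : ∃ i, f i = l
  · obtain ⟨i, rfl⟩ := hl
    rw [hf.extend_apply]; rfl
  · push Not at hl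
    rw [extend_apply_off f _ _ hl, h l hl]

theorem emb_mul {f : Fin m → Fin k} (hf : Function.Injective f)
    (X Y : Matrix (Fin m → Fin N) (Fin m → Fin N) α) : emb f (X * Y) = emb f X * emb f Y := by
  ext a b
  rw [Matrix.mul_apply, emb_apply, Matrix.mul_apply]
  split_ifs with h
  · refine Fintype.sum_of_injective (fun c => Function.extend f c a) ?_ _ _ ?_ ?_
    · intro c c' e
      funext i
      have := congrFun e (f i)
      simpa [hf.extend_apply] using this
    · intro c hc
      rw [emb_apply, if_neg, zero_mul]
      exact fun h' => hc ⟨c ∘ f, eq_extend hf h'⟩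
    · intro c
      have hc : Function.extend f c a ∘ f = c := by funext i; simp [hf.extend_apply]
      rw [emb_apply, emb_apply, if_pos, if_pos, hc]
      · intro l hl; rw [extend_apply_off f _ _ hl, h l hl]
      · intro l hl; rw [extend_apply_off f _ _ hl]
  · symm
    refine Finset.sum_eq_zero fun c _ => ?_
    rw [emb_apply, emb_apply]
    split_ifs with h1 h2
    · exact absurd (fun l hl => (h1 l hl).trans (h2 l hl)) h
    all_goals simp

theorem emb_one {f : Fin m → Fin k} (hf : Function.Injective f) :
    emb f (1 : Matrix (Fin m → Fin N) (Fin m → Fin N) α) = 1 := by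
  ext a b
  rw [emb_apply, Matrix.one_apply, Matrix.one_apply]
  by_cases hab : a = b
  · subst hab; simp
  · rw [if_neg hab]
    split_ifs with h1 h2
    · refine absurd ?_ hab
      rw [← eq_extend hf h1, ← h2, eq_extend hf fun _ _ => rfl]
    all_goals rfl

theorem emb_add (f : Fin m → Fin k) (X Y : Matrix (Fin m → Fin N) (Fin m → Fin N) α) :
    emb f (X + Y) = emb f X + emb f Y := by
  ext a b
  simp only [emb_apply, Matrix.add_apply]
  split_ifs <;> simp

theorem emb_mul_emb_apply {p : ℕ} {f : Fin m → Fin k} {g : Fin p → Fin k}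
    (hf : Function.Injective f) (hfg : ∀ i j, f i ≠ g j)
    (X : Matrix (Fin m → Fin N) (Fin m → Fin N) α) (Y : Matrix (Fin p → Fin N) (Fin p → Fin N) α)
    (a b : Fin k → Fin N) :
    (emb f X * emb g Y) a b =
      if ∀ l, (∀ i, f i ≠ l) → (∀ i, g i ≠ l) → a l = b l then
        X (a ∘ f) (b ∘ f) * Y (a ∘ g) (b ∘ g) else 0 := by
  have hc : Function.extend f (b ∘ f) a ∘ f = b ∘ f := by funext i; simp [hf.extend_apply]
  have hc' : Function.extend f (b ∘ f) a ∘ g = a ∘ g := by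
    funext i; exact extend_apply_off f _ _ fun j => hfg j i
  rw [Matrix.mul_apply, Finset.sum_eq_single (Function.extend f (b ∘ f) a)]
  · rw [emb_apply, emb_apply, if_pos, hc, hc', mul_ite, mul_zero]
    · refine if_congr ⟨?_, ?_⟩ rfl rfl
      · intro h l hl hl'
        rw [← h l hl', extend_apply_off f _ _ hl]
      · intro h l hl
        by_cases hl' : ∃ i, f i = l
        · obtain ⟨i, rfl⟩ := hl'
          exact congrFun hc i
        · push Not at hl'
          rw [extend_apply_off f _ _ hl', h l hl' hl]
    · intro l hl; rw [extend_apply_off f _ _ hl]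
  · intro c _ hcne
    rw [emb_apply, emb_apply]
    split_ifs with h1 h2
    · refine absurd ?_ hcne
      rw [← eq_extend hf h1]
      congr 1
      funext i
      exact h2 _ fun j hj => hfg i j hj.symm
    all_goals simp
  · simp

theorem commute_emb {p : ℕ} {f : Fin m → Fin k} {g : Fin p → Fin k}
    (hf : Function.Injective f) (hg : Function.Injective g) (hfg : ∀ i j, f i ≠ g j)
    {X : Matrix (Fin m → Fin N) (Fin m → Fin N) α} {Y : Matrix (Fin p → Fin N) (Fin p → Fin N) α}
    (hXY : ∀ a b c d, Commute (X a b) (Y c d)) : Commute (emb f X) (emb g Y) := by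
  refine Matrix.ext fun a b => ?_
  rw [emb_mul_emb_apply hf hfg, emb_mul_emb_apply hg fun i j => (hfg j i).symm,
    (hXY _ _ _ _).eq]
  exact if_congr ⟨fun h l hl hl' => h l hl' hl, fun h l hl hl' => h l hl' hl⟩ rfl rfl

theorem emb_matAt {f : Fin m → Fin k} (hf : Function.Injective f)
    (X : Matrix (Fin N) (Fin N) α) {i j : ℕ} (hi : i < m) (hj : (f ⟨i, hi⟩ : ℕ) = j) :
    emb f (matAt N m X i) = matAt N k X j := by
  subst hj
  ext a b
  simp only [emb_apply, matAt, hi, dif_pos, Fin.is_lt, Matrix.of_apply, Function.comp_apply,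
    Fin.eta]
  rw [← ite_and]
  refine if_congr ⟨?_, ?_⟩ rfl rfl
  · rintro ⟨h1, h2⟩ l hl
    by_cases hl' : ∃ i, f i = l
    · obtain ⟨i', rfl⟩ := hl'
      exact h2 i' fun h => hl (by subst h; rfl)
    · push Not at hl'
      exact h1 l hl'
  · refine fun h => ⟨fun l hl => h l fun h' => hl _ (Fin.ext h'.symm), fun l hl => h _ fun h' =>
      hl ?_⟩
    exact congrArg Fin.val (hf (Fin.ext h'))

theorem emb_opAt {f : Fin m → Fin k} (hf : Function.Injective f)
    (X : Matrix (Fin N × Fin N) (Fin N × Fin N) α) {i j : ℕ} (hi : i + 1 < m)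
    (hj : (f ⟨i, by omega⟩ : ℕ) = j) (hj' : (f ⟨i + 1, hi⟩ : ℕ) = j + 1) :
    emb f (opAt N m X i) = opAt N k X j := by
  have hjk : j + 1 < k := by rw [← hj']; exact Fin.is_lt _
  have e1 : (⟨j, by omega⟩ : Fin k) = f ⟨i, by omega⟩ := Fin.ext hj.symm
  have e2 : (⟨j + 1, hjk⟩ : Fin k) = f ⟨i + 1, hi⟩ := Fin.ext hj'.symm
  ext a b
  simp only [emb_apply, opAt, hi, hjk, dif_pos, Matrix.of_apply, Function.comp_apply, e1, e2]
  rw [← ite_and]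
  refine if_congr ⟨?_, ?_⟩ rfl rfl
  · rintro ⟨h1, h2⟩ l hl hl'
    by_cases hlf : ∃ i, f i = l
    · obtain ⟨i', rfl⟩ := hlf
      exact h2 i' (fun h => hl (by rw [← hj]; subst h; rfl))
        (fun h => hl' (by rw [← hj']; congr 2; exact Fin.ext h))
    · push Not at hlf
      exact h1 l hlf
  · refine fun h => ⟨fun l hl => h l (fun h' => hl _ (Fin.ext (hj.trans h'.symm)))
      (fun h' => hl _ (Fin.ext (hj'.trans h'.symm))), fun l hl hl' => h _ (fun h' => hl ?_)
      (fun h' => hl' ?_)⟩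
    · exact congrArg Fin.val (hf (Fin.ext (h'.trans hj.symm)))
    · exact congrArg Fin.val (hf (Fin.ext (h'.trans hj'.symm)))

/-- The site embedding `Fin m → Fin k` that shifts by `i`. -/
def shiftSite (i : ℕ) (h : i + m ≤ k) (j : Fin m) : Fin k := ⟨i + j, by omega⟩

theorem shiftSite_injective (i : ℕ) (h : i + m ≤ k) :
    Function.Injective (shiftSite i h : Fin m → Fin k) := fun a b e => by
  have := congrArg Fin.val e
  simp only [shiftSite] at this
  exact Fin.ext (by omega)

theorem matAt_eq_emb (X : Matrix (Fin N) (Fin N) α) {i : ℕ} (h : i + 1 ≤ k) :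
    matAt N k X i = emb (shiftSite i h) (matAt N 1 X 0) :=
  (emb_matAt (shiftSite_injective i h) X (by omega) (by simp [shiftSite])).symm

theorem opAt_eq_emb (X : Matrix (Fin N × Fin N) (Fin N × Fin N) α) {i : ℕ} (h : i + 2 ≤ k) :
    opAt N k X i = emb (shiftSite i h) (opAt N 2 X 0) :=
  (emb_opAt (shiftSite_injective i h) X (by omega) (by simp [shiftSite])
    (by simp [shiftSite])).symm

theorem emb_shift_matAt (X : Matrix (Fin N) (Fin N) α) {i j : ℕ} (h : i + m ≤ k) (hj : j < m) :
    emb (shiftSite i h) (matAt N m X j) = matAt N k X (i + j) :=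
  emb_matAt (shiftSite_injective i h) X hj rfl

theorem emb_shift_opAt (X : Matrix (Fin N × Fin N) (Fin N × Fin N) α) {i j : ℕ} (h : i + m ≤ k)
    (hj : j + 1 < m) : emb (shiftSite i h) (opAt N m X j) = opAt N k X (i + j) :=
  emb_opAt (shiftSite_injective i h) X hj rfl rfl

theorem opAt_two (X : Matrix (Fin N × Fin N) (Fin N × Fin N) α) :
    opAt N 2 X 0 = X.submatrix (finTwoArrowEquiv (Fin N)) (finTwoArrowEquiv (Fin N)) := by
  ext a b
  have : ∀ l : Fin 2, (l : ℕ) ≠ 0 → (l : ℕ) ≠ 0 + 1 → a l = b l := by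
    intro l h1 h2; omega
  simp only [opAt, Matrix.submatrix_apply]
  rw [dif_pos (by omega), Matrix.of_apply, if_pos this]
  rfl

theorem opAt_mul (X Y : Matrix (Fin N × Fin N) (Fin N × Fin N) α) (i : ℕ) :
    opAt N k (X * Y) i = opAt N k X i * opAt N k Y i := by
  by_cases h : i + 2 ≤ k
  · rw [opAt_eq_emb _ h, opAt_eq_emb _ h, opAt_eq_emb _ h, ← emb_mul (shiftSite_injective i h),
      opAt_two, opAt_two, opAt_two, Matrix.submatrix_mul_equiv]
  · simp only [opAt]
    rw [dif_neg (by omega), dif_neg (by omega), dif_neg (by omega), mul_one]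

theorem opAt_one (i : ℕ) :
    opAt N k (1 : Matrix (Fin N × Fin N) (Fin N × Fin N) α) i = 1 := by
  by_cases h : i + 2 ≤ k
  · rw [opAt_eq_emb _ h, opAt_two, Matrix.submatrix_one_equiv,
      emb_one (shiftSite_injective i h)]
  · simp only [opAt]
    rw [dif_neg (by omega)]

theorem opAt_add {i : ℕ} (h : i + 1 < k) (X Y : Matrix (Fin N × Fin N) (Fin N × Fin N) α) :
    opAt N k (X + Y) i = opAt N k X i + opAt N k Y i := by
  rw [opAt_eq_emb _ (Nat.succ_le_of_lt h), opAt_eq_emb _ (Nat.succ_le_of_lt h),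
    opAt_eq_emb _ (Nat.succ_le_of_lt h), ← emb_add, opAt_two, opAt_two, opAt_two]
  rfl

theorem commute_opAt_opAt {X : Matrix (Fin N × Fin N) (Fin N × Fin N) α}
    (hX : ∀ a b (x : α), Commute (X a b) x) {i j : ℕ} (h : i + 2 ≤ j) :
    Commute (opAt N k X i) (opAt N k X j) := by
  by_cases hj : j + 2 ≤ k
  · rw [opAt_eq_emb _ hj, opAt_eq_emb _ (show i + 2 ≤ k by omega)]
    refine commute_emb (shiftSite_injective _ _) (shiftSite_injective _ _) (fun a b e => ?_)
      fun a b c d => ?_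
    · have := congrArg Fin.val e
      simp only [shiftSite] at this
      omega
    · rw [opAt_two]; exact hX _ _ _
  · simp only [opAt]
    rw [dif_neg (show ¬ j + 1 < k by omega)]
    exact Commute.one_right _

theorem commute_opAt_matAt {X : Matrix (Fin N × Fin N) (Fin N × Fin N) α}
    (hX : ∀ a b (x : α), Commute (X a b) x) (Y : Matrix (Fin N) (Fin N) α) {i j : ℕ}
    (h : j ≠ i) (h' : j ≠ i + 1) : Commute (opAt N k X i) (matAt N k Y j) := by
  by_cases hi : i + 2 ≤ k
  · by_cases hj : j + 1 ≤ k
    · rw [opAt_eq_emb _ hi, matAt_eq_emb _ hj]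
      refine commute_emb (shiftSite_injective _ _) (shiftSite_injective _ _) (fun a b e => ?_)
        fun a b c d => ?_
      · have := congrArg Fin.val e
        simp only [shiftSite] at this
        omega
      · rw [opAt_two]; exact hX _ _ _
    · simp only [matAt]
      rw [dif_neg (by omega)]
      exact Commute.one_right _
  · simp only [opAt]
    rw [dif_neg (by omega)]
    exact Commute.one_left _

end Embedding

/-! ### Partial traces -/

section PartialTrace

variable {α : Type*} [Semiring α] {N m k : ℕ}

/-- The unweighted partial trace over the last tensor factor. -/
def lastTr (Y : Matrix (Fin (k + 1) → Fin N) (Fin (k + 1) → Fin N) α) :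
    Matrix (Fin k → Fin N) (Fin k → Fin N) α :=
  Matrix.of fun a b => ∑ c : Fin N,
    Y (Fin.snoc (α := fun _ => Fin N) a c) (Fin.snoc (α := fun _ => Fin N) b c)

/-- The partial quantum trace `Tr_{R(k+1)}`. -/
def lastQTr (C : Matrix (Fin N) (Fin N) α)
    (Y : Matrix (Fin (k + 1) → Fin N) (Fin (k + 1) → Fin N) α) :
    Matrix (Fin k → Fin N) (Fin k → Fin N) α :=
  lastTr (matAt N (k + 1) C k * Y)

theorem sum_snoc {β : Type*} [AddCommMonoid β] (F : (Fin (k + 1) → Fin N) → β) :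
    ∑ a, F a = ∑ a : Fin k → Fin N, ∑ c : Fin N, F (Fin.snoc (α := fun _ => Fin N) a c) := by
  rw [← (Fin.snocEquiv fun _ : Fin (k + 1) => Fin N).sum_comp, Fintype.sum_prod_type,
    Finset.sum_comm]
  rfl

theorem trace_lastTr (Y : Matrix (Fin (k + 1) → Fin N) (Fin (k + 1) → Fin N) α) :
    (lastTr Y).trace = Y.trace := by
  simp only [Matrix.trace, Matrix.diag_apply]
  rw [sum_snoc]
  rfl

theorem emb_castSucc_snoc (P : Matrix (Fin k → Fin N) (Fin k → Fin N) α)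
    (a b : Fin k → Fin N) (c d : Fin N) :
    emb Fin.castSucc P (Fin.snoc (α := fun _ => Fin N) a c) (Fin.snoc (α := fun _ => Fin N) b d) =
      if c = d then P a b else 0 := by
  rw [emb_apply]
  have h : ∀ (a : Fin k → Fin N) (c : Fin N),
      Fin.snoc (α := fun _ => Fin N) a c ∘ Fin.castSucc = a := by
    intro a c; funext i; simp
  rw [h, h]
  refine if_congr ⟨fun h => ?_, fun h l hl => ?_⟩ rfl rfl
  · simpa using h (Fin.last k) fun i => (Fin.castSucc_lt_last i).ne
  · induction l using Fin.lastCases with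
    | last => simpa using h
    | cast i => exact absurd rfl (hl i)

theorem lastTr_emb_mul (P : Matrix (Fin k → Fin N) (Fin k → Fin N) α)
    (Y : Matrix (Fin (k + 1) → Fin N) (Fin (k + 1) → Fin N) α) :
    lastTr (emb Fin.castSucc P * Y) = P * lastTr Y := by
  ext a b
  simp only [lastTr, Matrix.of_apply, Matrix.mul_apply, sum_snoc, emb_castSucc_snoc, ite_mul,
    zero_mul, Finset.sum_ite_eq, Finset.mem_univ, if_true, Finset.mul_sum]
  exact Finset.sum_comm

theorem lastTr_mul_emb (P : Matrix (Fin k → Fin N) (Fin k → Fin N) α)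
    (Y : Matrix (Fin (k + 1) → Fin N) (Fin (k + 1) → Fin N) α) :
    lastTr (Y * emb Fin.castSucc P) = lastTr Y * P := by
  ext a b
  simp only [lastTr, Matrix.of_apply, Matrix.mul_apply, sum_snoc, emb_castSucc_snoc, mul_ite,
    mul_zero, Finset.sum_ite_eq', Finset.mem_univ, if_true, Finset.sum_mul]
  exact Finset.sum_comm

theorem lastTr_emb {g : Fin (m + 1) → Fin (k + 1)} {f : Fin m → Fin k}
    (hc : ∀ i, g i.castSucc = (f i).castSucc) (hl : g (Fin.last m) = Fin.last k)
    (Y : Matrix (Fin (m + 1) → Fin N) (Fin (m + 1) → Fin N) α) :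
    lastTr (emb g Y) = emb f (lastTr Y) := by
  have h : ∀ (a : Fin k → Fin N) (c : Fin N), Fin.snoc (α := fun _ => Fin N) a c ∘ g =
      Fin.snoc (α := fun _ => Fin N) (a ∘ f) c := by
    intro a c
    funext i
    induction i using Fin.lastCases with
    | last => simp [hl]
    | cast i => simp [hc]
  ext a b
  have key : ∀ c : Fin N, (∀ l, (∀ i, g i ≠ l) → Fin.snoc (α := fun _ => Fin N) a c l =
      Fin.snoc (α := fun _ => Fin N) b c l) ↔ ∀ l, (∀ i, f i ≠ l) → a l = b l := by
    refine fun c => ⟨fun h l hl' => ?_, fun h l hl' => ?_⟩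
    · simpa using h l.castSucc fun i => by
        induction i using Fin.lastCases with
        | last => rw [hl]; exact (Fin.castSucc_lt_last l).ne'
        | cast i => rw [hc]; exact fun e => hl' i (Fin.castSucc_injective _ e)
    · induction l using Fin.lastCases with
      | last => exact absurd hl (hl' _)
      | cast l => simpa using h l fun i e => hl' i.castSucc (by rw [hc, e])
  simp only [lastTr, Matrix.of_apply, emb_apply, h, key]
  split_ifs
  · rfl
  · exact Finset.sum_const_zero

end PartialTrace

section PartialQuantumTrace

variable {α : Type*} [Semiring α] {N k : ℕ} {C : Matrix (Fin N) (Fin N) α}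

theorem matAt_snoc (X : Matrix (Fin N) (Fin N) α) (a b : Fin k → Fin N) (c d : Fin N) :
    matAt N (k + 1) X k (Fin.snoc (α := fun _ => Fin N) a c)
      (Fin.snoc (α := fun _ => Fin N) b d) = if a = b then X c d else 0 := by
  have hl : ∀ (a : Fin k → Fin N) (c : Fin N),
      Fin.snoc (α := fun _ => Fin N) a c ⟨k, Nat.lt_succ_self k⟩ = c := fun a c =>
    Fin.snoc_last (α := fun _ => Fin N) c a
  simp only [matAt]
  rw [dif_pos (Nat.lt_succ_self k), Matrix.of_apply, hl, hl]
  refine if_congr ⟨fun h => ?_, fun h l hl => ?_⟩ rfl rfl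
  · funext i
    simpa using h i.castSucc (by simp; omega)
  · subst h
    obtain ⟨l, rfl⟩ : ∃ l' : Fin k, l = l'.castSucc := ⟨⟨l, by omega⟩, rfl⟩
    simp

theorem commute_emb_castSucc_matAt (hC : ∀ i j (x : α), Commute (C i j) x)
    (P : Matrix (Fin k → Fin N) (Fin k → Fin N) α) :
    Commute (matAt N (k + 1) C k) (emb Fin.castSucc P) := by
  rw [matAt_eq_emb C le_rfl]
  refine commute_emb (shiftSite_injective _ _) (Fin.castSucc_injective _) (fun i j e => ?_)
    fun a b c d => ?_
  · have := congrArg Fin.val e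
    simp only [shiftSite, Fin.val_castSucc] at this
    omega
  · simp only [matAt]
    rw [dif_pos (by omega), Matrix.of_apply]
    split_ifs
    · exact hC _ _ _
    · exact Commute.zero_left _

theorem lastQTr_emb_mul (hC : ∀ i j (x : α), Commute (C i j) x)
    (P : Matrix (Fin k → Fin N) (Fin k → Fin N) α)
    (Y : Matrix (Fin (k + 1) → Fin N) (Fin (k + 1) → Fin N) α) :
    lastQTr C (emb Fin.castSucc P * Y) = P * lastQTr C Y := by
  rw [lastQTr, ← mul_assoc, (commute_emb_castSucc_matAt hC P).eq, mul_assoc, lastTr_emb_mul,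
    lastQTr]

theorem lastQTr_mul_emb (P : Matrix (Fin k → Fin N) (Fin k → Fin N) α)
    (Y : Matrix (Fin (k + 1) → Fin N) (Fin (k + 1) → Fin N) α) :
    lastQTr C (Y * emb Fin.castSucc P) = lastQTr C Y * P := by
  rw [lastQTr, ← mul_assoc, lastTr_mul_emb, lastQTr]

theorem lastTr_add (X Y : Matrix (Fin (k + 1) → Fin N) (Fin (k + 1) → Fin N) α) :
    lastTr (X + Y) = lastTr X + lastTr Y := by
  ext a b
  simp only [lastTr, Matrix.of_apply, Matrix.add_apply, Finset.sum_add_distrib]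

theorem lastQTr_add (X Y : Matrix (Fin (k + 1) → Fin N) (Fin (k + 1) → Fin N) α) :
    lastQTr C (X + Y) = lastQTr C X + lastQTr C Y := by
  rw [lastQTr, mul_add, lastTr_add, lastQTr, lastQTr]

theorem lastQTr_smul {A : Type*} [Ring A] [Algebra ℂ A] {C : Matrix (Fin N) (Fin N) A} (c : ℂ)
    (X : Matrix (Fin (k + 1) → Fin N) (Fin (k + 1) → Fin N) A) :
    lastQTr C (c • X) = c • lastQTr C X := by
  rw [lastQTr, Algebra.mul_smul_comm]
  ext a b
  simp only [lastQTr, lastTr, Matrix.of_apply, Matrix.smul_apply, Finset.smul_sum]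

theorem lastQTr_zero : lastQTr C (0 : Matrix (Fin (k + 1) → Fin N) _ α) = 0 := by
  rw [lastQTr, mul_zero]
  ext a b
  simp [lastTr]

theorem lastQTr_one :
    lastQTr C (1 : Matrix (Fin (k + 1) → Fin N) (Fin (k + 1) → Fin N) α) =
      Matrix.diagonal fun _ => C.trace := by
  ext a b
  rw [lastQTr, mul_one, lastTr, Matrix.of_apply, Matrix.diagonal_apply]
  simp only [matAt_snoc]
  split_ifs
  · rfl
  · simp

theorem prod_matAt_succ {n : ℕ} (h : n ≤ k) :
    ((List.range n).map (matAt N (k + 1) C)).prod =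
      emb Fin.castSucc ((List.range n).map (matAt N k C)).prod := by
  induction n with
  | zero => simp [emb_one (Fin.castSucc_injective k)]
  | succ n ih =>
    rw [List.range_succ, List.map_append, List.prod_append, ih (by omega), List.map_append,
      List.prod_append, emb_mul (Fin.castSucc_injective k)]
    simp only [List.map_cons, List.map_nil, List.prod_singleton]
    rw [emb_matAt (j := n) (Fin.castSucc_injective k) C (show n < k by omega) rfl]

theorem qTr_succ (X : Matrix (Fin (k + 1) → Fin N) (Fin (k + 1) → Fin N) α) :
    qTr N (k + 1) C X = qTr N k C (lastQTr C X) := by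
  rw [qTr, List.range_succ, List.map_append, List.prod_append, prod_matAt_succ le_rfl]
  simp only [List.map_cons, List.map_nil, List.prod_singleton]
  rw [mul_assoc, ← trace_lastTr, lastTr_emb_mul, qTr, lastQTr]

theorem qTr_add (X Y : Matrix (Fin k → Fin N) (Fin k → Fin N) α) :
    qTr N k C (X + Y) = qTr N k C X + qTr N k C Y := by
  rw [qTr, mul_add, Matrix.trace_add, qTr, qTr]

theorem qTr_zero (C : Matrix (Fin N) (Fin N) α) :
    qTr N k C (0 : Matrix (Fin k → Fin N) (Fin k → Fin N) α) = 0 := by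
  rw [qTr, mul_zero, Matrix.trace_zero]

theorem qTr_smul {A : Type*} [Ring A] [Algebra ℂ A] {C : Matrix (Fin N) (Fin N) A} (c : ℂ)
    (X : Matrix (Fin k → Fin N) (Fin k → Fin N) A) :
    qTr N k C (c • X) = c • qTr N k C X := by
  rw [qTr, Algebra.mul_smul_comm, Matrix.trace_smul, qTr]

/-- If the partial quantum trace of `R` over the second factor is the identity, then so is the
partial quantum trace of the last generator. -/
theorem lastQTr_opAt {R : Matrix (Fin N × Fin N) (Fin N × Fin N) α}
    (h : lastQTr C (opAt N 2 R 0) = 1) : lastQTr C (opAt N (k + 2) R k) = 1 := by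
  have hinj := shiftSite_injective k (show k + 1 ≤ k + 1 by omega)
  rw [← emb_one hinj, ← h, lastQTr, lastQTr, opAt_eq_emb R le_rfl,
    ← lastTr_emb (g := shiftSite k (show k + 2 ≤ k + 2 by omega)), emb_mul
      (shiftSite_injective _ _), emb_shift_matAt _ _ (by omega)]
  · intro i; rfl
  · rfl

/-! ### Slices in the first tensor factor -/

/-- The matrix coefficient of `Z` at `(u, v)` with respect to the first tensor factor. -/
def slice (u v : Fin N) (Z : Matrix (Fin (k + 1) → Fin N) (Fin (k + 1) → Fin N) α) :
    Matrix (Fin k → Fin N) (Fin k → Fin N) α :=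
  Matrix.of fun a b => Z (Fin.cons (α := fun _ => Fin N) u a) (Fin.cons (α := fun _ => Fin N) v b)

theorem sum_cons {β : Type*} [AddCommMonoid β] (F : (Fin (k + 1) → Fin N) → β) :
    ∑ a, F a = ∑ c : Fin N, ∑ a : Fin k → Fin N, F (Fin.cons (α := fun _ => Fin N) c a) := by
  rw [← (Fin.consEquiv fun _ : Fin (k + 1) => Fin N).sum_comp, Fintype.sum_prod_type]
  rfl

theorem emb_succ_cons (P : Matrix (Fin k → Fin N) (Fin k → Fin N) α)
    (a b : Fin k → Fin N) (c d : Fin N) :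
    emb Fin.succ P (Fin.cons (α := fun _ => Fin N) c a) (Fin.cons (α := fun _ => Fin N) d b) =
      if c = d then P a b else 0 := by
  rw [emb_apply]
  have h : ∀ (a : Fin k → Fin N) (c : Fin N),
      Fin.cons (α := fun _ => Fin N) c a ∘ Fin.succ = a := by
    intro a c; funext i; simp
  rw [h, h]
  refine if_congr ⟨fun h => ?_, fun h l hl => ?_⟩ rfl rfl
  · simpa using h 0 fun i => Fin.succ_ne_zero i
  · induction l using Fin.cases with
    | zero => simpa using h
    | succ i => exact absurd rfl (hl i)

theorem slice_emb_mul (u v : Fin N) (P : Matrix (Fin k → Fin N) (Fin k → Fin N) α)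
    (Y : Matrix (Fin (k + 1) → Fin N) (Fin (k + 1) → Fin N) α) :
    slice u v (emb Fin.succ P * Y) = P * slice u v Y := by
  ext a b
  simp only [slice, Matrix.of_apply, Matrix.mul_apply, sum_cons, emb_succ_cons, ite_mul,
    zero_mul]
  rw [Finset.sum_eq_single u]
  · simp
  · intro c _ hc; simp [hc.symm]
  · simp

theorem slice_mul_emb (u v : Fin N) (P : Matrix (Fin k → Fin N) (Fin k → Fin N) α)
    (Y : Matrix (Fin (k + 1) → Fin N) (Fin (k + 1) → Fin N) α) :
    slice u v (Y * emb Fin.succ P) = slice u v Y * P := by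
  ext a b
  simp only [slice, Matrix.of_apply, Matrix.mul_apply, sum_cons, emb_succ_cons, mul_ite,
    mul_zero]
  rw [Finset.sum_eq_single v]
  · simp
  · intro c _ hc; simp [hc]
  · simp

theorem slice_one (u v : Fin N) :
    slice u v (1 : Matrix (Fin (k + 1) → Fin N) (Fin (k + 1) → Fin N) α) =
      if u = v then 1 else 0 := by
  rw [← emb_one (Fin.succ_injective k)]
  ext a b
  simp only [slice, Matrix.of_apply, emb_succ_cons]
  split_ifs <;> rfl

theorem slice_lastTr (u v : Fin N)
    (Y : Matrix (Fin (k + 1 + 1) → Fin N) (Fin (k + 1 + 1) → Fin N) α) :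
    slice u v (lastTr Y) = lastTr (slice u v Y) := by
  ext a b
  simp only [slice, lastTr, Matrix.of_apply, Fin.cons_snoc_eq_snoc_cons]

theorem slice_lastQTr (u v : Fin N)
    (Y : Matrix (Fin (k + 1 + 1) → Fin N) (Fin (k + 1 + 1) → Fin N) α) :
    slice u v (lastQTr C Y) = lastQTr C (slice u v Y) := by
  rw [lastQTr, lastQTr, slice_lastTr,
    ← emb_matAt (j := k + 1) (Fin.succ_injective (k + 1)) C (show k < k + 1 by omega) rfl, slice_emb_mul]

theorem slice_emb_castSucc (u v : Fin N)
    (Y : Matrix (Fin (k + 1) → Fin N) (Fin (k + 1) → Fin N) α) :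
    slice u v (emb Fin.castSucc Y) = emb Fin.castSucc (slice u v Y) := by
  refine Matrix.ext fun a b => ?_
  refine Fin.snocCases (fun a c => ?_) a
  refine Fin.snocCases (fun b d => ?_) b
  simp only [slice, Matrix.of_apply, Fin.cons_snoc_eq_snoc_cons, emb_castSucc_snoc]

theorem slice_mul (u v : Fin N)
    (X Y : Matrix (Fin (k + 1) → Fin N) (Fin (k + 1) → Fin N) α) :
    slice u v (X * Y) = ∑ s, slice u s X * slice s v Y := by
  ext a b
  simp only [slice, Matrix.of_apply, Matrix.mul_apply, sum_cons, Matrix.sum_apply]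

theorem trace_eq_sum_slice (X : Matrix (Fin (k + 1) → Fin N) (Fin (k + 1) → Fin N) α) :
    X.trace = ∑ u, (slice u u X).trace := by
  simp only [Matrix.trace, Matrix.diag_apply, sum_cons]
  rfl

end PartialQuantumTrace

/-! ### The matrix `C` of a skew-invertible Hecke symmetry -/

section SkewInvertible

variable {N : ℕ} {lam : ℂ} {R Rinv Ψ : Matrix (Fin N × Fin N) (Fin N × Fin N) ℂ}

theorem opAt_two_apply {α : Type*} [Semiring α] (X : Matrix (Fin N × Fin N) (Fin N × Fin N) α)
    (a b : Fin 2 → Fin N) : opAt N 2 X 0 a b = X (a 0, a 1) (b 0, b 1) := by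
  rw [opAt_two]; rfl

theorem lastQTr_R (hΨ : SkewInv N R Ψ) : lastQTr (traceMat N Ψ) (opAt N 2 R 0) = 1 := by
  ext a b
  have h0 : ∀ (a : Fin 1 → Fin N) (c : Fin N), Fin.snoc (α := fun _ => Fin N) a c (0 : Fin 2) =
    a 0 := fun a c => Fin.snoc_castSucc (α := fun _ : Fin 2 => Fin N) c a 0
  have h1 : ∀ (a : Fin 1 → Fin N) (c : Fin N), Fin.snoc (α := fun _ => Fin N) a c (1 : Fin 2) =
    c := fun a c => Fin.snoc_last (α := fun _ : Fin 2 => Fin N) c a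
  have hab : a = b ↔ a 0 = b 0 :=
    ⟨fun h => by rw [h], fun h => funext fun i => by rw [Subsingleton.elim i 0, h]⟩
  have key : ∑ c, ∑ e, traceMat N Ψ c e * R (a 0, e) (b 0, c) = if a 0 = b 0 then 1 else 0 := by
    have e1 : ∀ k, ∑ j, ∑ l, R (a 0, j) (b 0, l) * Ψ (l, k) (j, k) =
        if k = b 0 then (if a 0 = b 0 then 1 else 0) else 0 := by
      intro k
      rw [hΨ.1 (a 0) k (b 0) k, ← ite_and]
      exact if_congr (by constructor <;> (rintro ⟨rfl, h⟩; simp_all)) rfl rfl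
    have e2 := Finset.sum_congr (rfl : (Finset.univ : Finset (Fin N)) = _) fun k _ => e1 k
    rw [Finset.sum_ite_eq' Finset.univ, if_pos (Finset.mem_univ _)] at e2
    rw [← e2, Finset.sum_comm,
      Finset.sum_comm (f := fun k j => ∑ l, R (a 0, j) (b 0, l) * Ψ (l, k) (j, k))]
    refine Finset.sum_congr rfl fun e _ => ?_
    rw [Finset.sum_comm (f := fun k l => R (a 0, e) (b 0, l) * Ψ (l, k) (e, k))]
    refine Finset.sum_congr rfl fun c _ => ?_
    simp only [traceMat, Matrix.of_apply, Finset.sum_mul]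
    exact Finset.sum_congr rfl fun x _ => mul_comm _ _
  rw [Matrix.one_apply, if_congr hab rfl rfl, ← key]
  simp only [lastQTr, lastTr, Matrix.of_apply]
  refine Finset.sum_congr rfl fun c _ => ?_
  rw [Matrix.mul_apply, sum_snoc (k := 1), Finset.sum_eq_single a]
  · refine Finset.sum_congr rfl fun e _ => ?_
    rw [matAt_snoc (k := 1), opAt_two_apply, h0, h0, h1, h1, if_pos rfl]
  · intro x _ hx
    refine Finset.sum_eq_zero fun e _ => ?_
    rw [matAt_snoc (k := 1), if_neg hx.symm, zero_mul]
  · simp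

theorem mem_span_slice (hΨ : SkewInv N R Ψ) (X : Matrix (Fin 1 → Fin N) (Fin 1 → Fin N) ℂ) :
    X ∈ Submodule.span ℂ (Set.range fun p : Fin N × Fin N => slice p.1 p.2 (opAt N 2 R 0)) := by
  have hX : X = ∑ l, ∑ i, X (fun _ => l) (fun _ => i) •
      ∑ j, ∑ b, Ψ (i, j) (l, b) • slice b j (opAt N 2 R 0) := by
    ext x y
    simp only [Matrix.sum_apply, Matrix.smul_apply, slice, Matrix.of_apply, opAt_two_apply,
      Fin.cons_zero, smul_eq_mul]
    have h1 : ∀ (a : Fin 1 → Fin N) (c : Fin N), Fin.cons (α := fun _ => Fin N) c a (1 : Fin 2) =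
      a 0 := fun a c => Fin.cons_succ (α := fun _ : Fin 2 => Fin N) c a 0
    have hx : ∀ a : Fin 1 → Fin N, (fun _ => a 0) = a := fun a =>
      funext fun i => by rw [Subsingleton.elim i 0]
    simp only [h1, hΨ.2]
    rw [Finset.sum_eq_single (x 0), Finset.sum_eq_single (y 0)]
    · simp [hx]
    · intro i _ hi; simp [hi]
    · simp
    · intro l _ hl; simp [hl.symm]
    · simp
  rw [hX]
  exact sum_mem fun l _ => sum_mem fun i _ => Submodule.smul_mem _ _ <|
    sum_mem fun j _ => sum_mem fun b _ => Submodule.smul_mem _ _ <|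
      Submodule.subset_span ⟨(b, j), rfl⟩

/-- `Tr_{R(2)}(R X₁ R⁻¹) = Tr_R(X) I`. -/
theorem lastQTr_conj (hRinv : R * Rinv = 1 ∧ Rinv * R = 1) (hbraid : IsBraid N R)
    (hΨ : SkewInv N R Ψ) (X : Matrix (Fin 1 → Fin N) (Fin 1 → Fin N) ℂ) :
    lastQTr (traceMat N Ψ) (opAt N 2 R 0 * emb Fin.castSucc X * opAt N 2 Rinv 0) =
      qTr N 1 (traceMat N Ψ) X • 1 := by
  have hC : ∀ i j (x : ℂ), Commute (traceMat N Ψ i j) x := fun _ _ _ => Commute.all _ _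
  have hinv : opAt N 2 Rinv 0 * opAt N 2 R 0 = 1 := by rw [← opAt_mul, hRinv.2, opAt_one]
  have hsl : ∀ u v : Fin N, lastQTr (traceMat N Ψ)
      (opAt N 2 R 0 * emb Fin.castSucc (slice u v (opAt N 2 R 0)) * opAt N 2 Rinv 0) =
        if u = v then 1 else 0 := by
    intro u v
    have e : opAt N 3 R 1 * opAt N 3 R 0 * opAt N 3 Rinv 1 =
        opAt N 3 Rinv 0 * (opAt N 3 R 1 * opAt N 3 R 0) := by
      have h0 : opAt N 3 Rinv 0 * opAt N 3 R 0 = 1 := by rw [← opAt_mul, hRinv.2, opAt_one]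
      have h1 : opAt N 3 R 1 * opAt N 3 Rinv 1 = 1 := by rw [← opAt_mul, hRinv.1, opAt_one]
      have := congrArg (fun x => opAt N 3 Rinv 0 * x * opAt N 3 Rinv 1) hbraid
      simp only [← mul_assoc, h0, one_mul] at this ⊢
      rw [this, mul_assoc _ (opAt N 3 R 1), h1, mul_one]
    have hcs : ∀ Y : Matrix (Fin N × Fin N) (Fin N × Fin N) ℂ,
        opAt N 3 Y 0 = emb Fin.castSucc (opAt N 2 Y 0) := fun Y =>
      (emb_opAt (Fin.castSucc_injective 2) Y (by omega) rfl rfl).symm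
    have hs : ∀ Y : Matrix (Fin N × Fin N) (Fin N × Fin N) ℂ,
        opAt N 3 Y 1 = emb Fin.succ (opAt N 2 Y 0) := fun Y =>
      (emb_opAt (Fin.succ_injective 2) Y (by omega) rfl rfl).symm
    have h1 : lastQTr (traceMat N Ψ) (opAt N 3 R 1 * opAt N 3 R 0 * opAt N 3 Rinv 1) = 1 := by
      rw [e, hcs, hcs, lastQTr_emb_mul hC, lastQTr_mul_emb, lastQTr_opAt (lastQTr_R hΨ), one_mul,
        hinv]
    have h2 := congrArg (slice u v) h1
    rwa [slice_lastQTr, hs, hs, hcs, slice_mul_emb, slice_emb_mul, slice_emb_castSucc,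
      slice_one] at h2
  have hq : ∀ u v : Fin N, qTr N 1 (traceMat N Ψ) (slice u v (opAt N 2 R 0)) =
      if u = v then 1 else 0 := by
    intro u v
    rw [qTr_succ, ← slice_lastQTr, lastQTr_R hΨ, slice_one]
    split_ifs <;> simp [qTr, Matrix.trace]
  refine Submodule.span_induction (p := fun X _ => lastQTr (traceMat N Ψ)
    (opAt N 2 R 0 * emb Fin.castSucc X * opAt N 2 Rinv 0) = qTr N 1 (traceMat N Ψ) X • 1)
    ?_ ?_ ?_ ?_ (mem_span_slice hΨ X)
  · rintro _ ⟨⟨u, v⟩, rfl⟩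
    rw [hsl, hq]
    split_ifs <;> simp
  · have : emb Fin.castSucc (0 : Matrix (Fin 1 → Fin N) (Fin 1 → Fin N) ℂ) = 0 := by
      ext a b; simp [emb_apply]
    rw [this, mul_zero, zero_mul, lastQTr_zero, qTr_zero, zero_smul]
  · intro X Y _ _ hX hY
    rw [emb_add, mul_add, add_mul, lastQTr_add, hX, hY, qTr_add, add_smul]
  · intro c X _ hX
    have : emb Fin.castSucc (c • X) = c • emb Fin.castSucc X := by
      ext a b; simp [emb_apply]
    rw [this, mul_smul_comm, smul_mul_assoc, lastQTr_smul, hX, qTr_smul, smul_assoc]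

/-- `Tr_{R(2)}(R X₁ R) = Tr_R(X) I + (q - q⁻¹) X`. -/
theorem lastQTr_mul_mul (hRinv : R * Rinv = 1 ∧ Rinv * R = 1) (hbraid : IsBraid N R)
    (hH : R = Rinv + lam • 1) (hΨ : SkewInv N R Ψ)
    (X : Matrix (Fin 1 → Fin N) (Fin 1 → Fin N) ℂ) :
    lastQTr (traceMat N Ψ) (opAt N 2 R 0 * emb Fin.castSucc X * opAt N 2 R 0) =
      qTr N 1 (traceMat N Ψ) X • 1 + lam • X := by
  have h : opAt N 2 R 0 = opAt N 2 Rinv 0 + lam • 1 := by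
    nth_rewrite 1 [hH]
    rw [opAt_add (by omega), ← opAt_one (k := 2) 0, opAt_two, opAt_two, opAt_two]
    rfl
  nth_rewrite 2 [h]
  rw [mul_add, lastQTr_add, lastQTr_conj hRinv hbraid hΨ, mul_smul_comm, mul_one, lastQTr_smul,
    lastQTr_mul_emb, lastQTr_R hΨ, one_mul]

/-- `R C₁ C₂ = C₁ C₂ R`. -/
theorem commute_opAt_two (hRinv : R * Rinv = 1 ∧ Rinv * R = 1) (hbraid : IsBraid N R)
    (hH : R = Rinv + lam • 1) (hΨ : SkewInv N R Ψ) :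
    Commute (opAt N 2 R 0) (matAt N 2 (traceMat N Ψ) 0 * matAt N 2 (traceMat N Ψ) 1) := by
  set C := traceMat N Ψ with hCdef
  have hC : ∀ i j (x : ℂ), Commute (C i j) x := fun _ _ _ => Commute.all _ _
  set r := opAt N 2 R 0 with hr
  set P := matAt N 2 C 0 * matAt N 2 C 1 with hP
  have hq : ∀ W, qTr N 2 C W = (P * W).trace := by
    intro W; simp [qTr, hP, List.range_succ]
  have hcyc : ∀ X Y : Matrix (Fin 1 → Fin N) (Fin 1 → Fin N) ℂ,
      qTr N 2 C (r * (emb Fin.castSucc X * r * emb Fin.castSucc Y)) =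
        qTr N 2 C (emb Fin.castSucc X * r * emb Fin.castSucc Y * r) := by
    intro X Y
    have e1 : r * (emb Fin.castSucc X * r * emb Fin.castSucc Y) =
      r * emb Fin.castSucc X * r * emb Fin.castSucc Y := by simp only [mul_assoc]
    have e2 : emb Fin.castSucc X * r * emb Fin.castSucc Y * r =
      emb Fin.castSucc X * (r * emb Fin.castSucc Y * r) := by simp only [mul_assoc]
    rw [e1, e2, qTr_succ (k := 1) (_ * emb Fin.castSucc Y), qTr_succ (k := 1), lastQTr_mul_emb, lastQTr_emb_mul hC,
      lastQTr_mul_mul hRinv hbraid hH hΨ, lastQTr_mul_mul hRinv hbraid hH hΨ, add_mul, mul_add,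
      smul_mul_assoc, one_mul, mul_smul_comm, mul_one, smul_mul_assoc, mul_smul_comm, qTr_add,
      qTr_add, qTr_smul, qTr_smul, qTr_smul, ← hCdef, smul_eq_mul, smul_eq_mul, smul_eq_mul,
      mul_comm (qTr N 1 C X)]
  set F := r * P - P * r with hF
  have hF0 : ∀ X Y : Matrix (Fin 1 → Fin N) (Fin 1 → Fin N) ℂ,
      (F * (emb Fin.castSucc X * r * emb Fin.castSucc Y)).trace = 0 := by
    intro X Y
    have := hcyc X Y
    rw [hq, hq] at this
    rw [hF, sub_mul, Matrix.trace_sub, mul_assoc P, this, mul_assoc r, Matrix.trace_mul_comm,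
      mul_assoc P, sub_self]
  have hsl : ∀ u v b j, (slice v u F * slice b j r).trace = 0 := by
    intro u v b j
    have hcons : ∀ (z : Fin N) (x : Fin 0 → Fin N),
        Fin.cons (α := fun _ => Fin N) z x = fun _ : Fin 1 => z := fun z x =>
      funext fun i => by rw [show i = 0 from Subsingleton.elim (α := Fin 1) i 0, Fin.cons_zero]
    have hs : ∀ p s p' s' : Fin N, slice p s (emb Fin.castSucc
        (Matrix.single (fun _ => p') (fun _ => s') 1 :
          Matrix (Fin 1 → Fin N) (Fin 1 → Fin N) ℂ)) = if p = p' ∧ s = s' then 1 else 0 := by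
      intro p s p' s'
      rw [slice_emb_castSucc]
      split_ifs with h
      · rw [← emb_one (Fin.castSucc_injective 0)]
        congr 1
        ext x y
        rw [Subsingleton.elim y x, Matrix.one_apply_eq, slice, Matrix.of_apply, h.1, h.2,
          hcons, hcons, Matrix.single_apply_same]
      · ext x y
        rw [emb_apply, slice, Matrix.of_apply, hcons, hcons, Matrix.single_apply_of_ne, ite_self,
          Matrix.zero_apply]
        exact fun h' => h ⟨(congrFun h'.1 0).symm, (congrFun h'.2 0).symm⟩
    have h := hF0 (Matrix.single (fun _ => u) (fun _ => b) 1)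
      (Matrix.single (fun _ => j) (fun _ => v) 1)
    rw [trace_eq_sum_slice] at h
    simp only [slice_mul, hs] at h
    simp only [ite_and, ite_mul, one_mul, zero_mul, Finset.sum_ite_irrel, Finset.sum_const_zero,
      Finset.sum_ite_eq', Finset.mem_univ, if_true, mul_ite, mul_one, mul_zero] at h
    simpa [apply_ite Matrix.trace] using h
  have hall : ∀ u v X, (slice v u F * X).trace = 0 := by
    intro u v X
    refine Submodule.span_induction (p := fun X _ => (slice v u F * X).trace = 0)
      ?_ ?_ ?_ ?_ (mem_span_slice hΨ X)
    · rintro _ ⟨⟨b, j⟩, rfl⟩; exact hsl u v b j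
    · simp
    · intro X Y _ _ hX hY; rw [mul_add, Matrix.trace_add, hX, hY, add_zero]
    · intro c X _ hX; rw [mul_smul_comm, Matrix.trace_smul, hX, smul_zero]
  have hz : F = 0 := by
    ext a b
    have h : slice (a 0) (b 0) F = 0 := Matrix.ext_iff_trace_mul_right.2 fun X => by
      rw [hall (b 0) (a 0) X, zero_mul, Matrix.trace_zero]
    have h2 := congrFun (congrFun h (Fin.tail a)) (Fin.tail b)
    simpa [slice] using h2
  exact sub_eq_zero.1 hz

end SkewInvertible

/-! ### Numeric matrices over the algebra -/

section ToA

variable {A : Type*} [Ring A] [Algebra ℂ A] {N k : ℕ}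

theorem toA_mul {ι : Type*} [Fintype ι] (X Y : Matrix ι ι ℂ) :
    toA A (X * Y) = toA A X * toA A Y := Matrix.map_mul

theorem toA_one {ι : Type*} [DecidableEq ι] : toA A (1 : Matrix ι ι ℂ) = 1 :=
  Matrix.map_one _ (map_zero _) (map_one _)

theorem commute_toA {ι : Type*} (X : Matrix ι ι ℂ) (i j : ι) (x : A) : Commute (toA A X i j) x :=
  Algebra.commutes _ _

theorem trace_toA_mul_comm {ι : Type*} [Fintype ι] (X : Matrix ι ι ℂ) (Y : Matrix ι ι A) :
    (toA A X * Y).trace = (Y * toA A X).trace := by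
  simp only [Matrix.trace, Matrix.diag_apply, Matrix.mul_apply]
  rw [Finset.sum_comm]
  exact Finset.sum_congr rfl fun i _ => Finset.sum_congr rfl fun j _ => commute_toA X _ _ _

theorem opAt_toA (X : Matrix (Fin N × Fin N) (Fin N × Fin N) ℂ) (i : ℕ) :
    opAt N k (toA A X) i = toA A (opAt N k X i) := by
  simp only [opAt]
  split_ifs with h
  · ext a b
    simp only [toA, Matrix.of_apply, Matrix.map_apply]
    split_ifs <;> simp
  · exact toA_one.symm

theorem matAt_toA (X : Matrix (Fin N) (Fin N) ℂ) (i : ℕ) :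
    matAt N k (toA A X) i = toA A (matAt N k X i) := by
  simp only [matAt]
  split_ifs with h
  · ext a b
    simp only [toA, Matrix.of_apply, Matrix.map_apply]
    split_ifs <;> simp
  · exact toA_one.symm

theorem lastQTr_toA (C : Matrix (Fin N) (Fin N) ℂ)
    (Y : Matrix (Fin (k + 1) → Fin N) (Fin (k + 1) → Fin N) ℂ) :
    lastQTr (toA A C) (toA A Y) = toA A (lastQTr C Y) := by
  rw [lastQTr, lastQTr, matAt_toA, ← toA_mul]
  ext a b
  simp only [lastTr, toA, Matrix.of_apply, Matrix.map_apply, map_sum]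

end ToA

section Embedding

variable {A : Type*} [Ring A] [Algebra ℂ A] {N m k : ℕ}

theorem emb_algebraMap {f : Fin m → Fin k} (hf : Function.Injective f) (c : ℂ) :
    emb f (algebraMap ℂ (Matrix (Fin m → Fin N) (Fin m → Fin N) A) c) = algebraMap ℂ _ c := by
  rw [Algebra.algebraMap_eq_smul_one, Algebra.algebraMap_eq_smul_one, ← emb_one hf]
  ext a b
  simp only [emb_apply, Matrix.smul_apply, smul_ite, smul_zero]

theorem matAt_mul {α : Type*} [Semiring α] (h : 1 ≤ k) (X Y : Matrix (Fin N) (Fin N) α) :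
    matAt N k (X * Y) 0 = matAt N k X 0 * matAt N k Y 0 := by
  rw [matAt_eq_emb _ h, matAt_eq_emb X h, matAt_eq_emb Y h, ← emb_mul (shiftSite_injective 0 h)]
  congr 1
  ext a b
  have h0 : ∀ (Z : Matrix (Fin N) (Fin N) α) (a b : Fin 1 → Fin N),
      matAt N 1 Z 0 a b = Z (a 0) (b 0) := by
    intro Z a b
    simp only [matAt]
    rw [dif_pos (by omega), Matrix.of_apply, if_pos fun l hl => absurd (by omega) hl]
    rfl
  simp only [Matrix.mul_apply, h0]
  exact ((Equiv.funUnique (Fin 1) (Fin N)).sum_comp fun j => X (a 0) j * Y j (b 0)).symm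

theorem emb_ovCopy {α : Type*} [Semiring α] (R Rinv : Matrix (Fin N × Fin N) (Fin N × Fin N) α)
    (X : Matrix (Fin N) (Fin N) α) {n : ℕ} (h : n < k) :
    emb Fin.castSucc (ovCopy N k R Rinv X n) = ovCopy N (k + 1) R Rinv X n := by
  have hinj := Fin.castSucc_injective k
  induction n with
  | zero => exact emb_matAt hinj X h rfl
  | succ n ih =>
    rw [ovCopy, emb_mul hinj, emb_mul hinj, ih (by omega), emb_opAt (j := n) hinj R h rfl rfl,
      emb_opAt (j := n) hinj Rinv h rfl rfl, ovCopy]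

theorem emb_ovProd {α : Type*} [Ring α] (R Rinv : Matrix (Fin N × Fin N) (Fin N × Fin N) α)
    (X : Matrix (Fin N) (Fin N) α) {n : ℕ} (h : n ≤ k) :
    emb Fin.castSucc (ovProd N k R Rinv X n) = ovProd N (k + 1) R Rinv X n := by
  have hinj := Fin.castSucc_injective k
  induction n with
  | zero => exact emb_one hinj
  | succ n ih =>
    change emb Fin.castSucc (prodSeq _ _) = prodSeq _ _
    rw [prodSeq_succ, prodSeq_succ, emb_mul hinj, emb_ovCopy R Rinv X h]
    exact congrArg (· * _) (ih (by omega))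

theorem exists_emb_of_mem_heckeSub {R : Matrix (Fin N × Fin N) (Fin N × Fin N) A} {n : ℕ}
    (h : n ≤ k) {x : Matrix (Fin (k + 1) → Fin N) (Fin (k + 1) → Fin N) A}
    (hx : x ∈ heckeSub (opAt N (k + 1) R) n) :
    ∃ y ∈ heckeSub (opAt N k R) n, x = emb Fin.castSucc y := by
  have hinj := Fin.castSucc_injective k
  induction hx using Algebra.adjoin_induction with
  | mem x hx =>
    obtain ⟨i, hi, rfl⟩ := hx
    exact ⟨_, gen_mem_heckeSub hi, (emb_opAt hinj R (by omega) rfl rfl).symm⟩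
  | algebraMap c => exact ⟨_, Subalgebra.algebraMap_mem _ c, (emb_algebraMap hinj c).symm⟩
  | add x y _ _ hx hy =>
    obtain ⟨x, hx, rfl⟩ := hx
    obtain ⟨y, hy, rfl⟩ := hy
    exact ⟨_, add_mem hx hy, (emb_add _ _ _).symm⟩
  | mul x y _ _ hx hy =>
    obtain ⟨x, hx, rfl⟩ := hx
    obtain ⟨y, hy, rfl⟩ := hy
    exact ⟨_, mul_mem hx hy, (emb_mul hinj _ _).symm⟩

end Embedding

/-! ### Hecke symmetries -/

section HeckeSymmetry

variable {A : Type*} [Ring A] [Algebra ℂ A] {N k : ℕ} {lam : ℂ}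
  {R Rinv Ψ : Matrix (Fin N × Fin N) (Fin N × Fin N) ℂ}

theorem IsHecke.eq_add {q : ℂ} (hq : q ≠ 0) (hH : IsHecke N q R)
    (hRinv : R * Rinv = 1 ∧ Rinv * R = 1) : R = Rinv + (q - q⁻¹) • 1 := by
  have h : (1 : Matrix (Fin N × Fin N) (Fin N × Fin N) ℂ) + (q - q⁻¹) • R - R * R = 0 := by
    rw [← hH, sub_mul, mul_add, mul_add, smul_mul_smul_comm, mul_inv_cancel₀ hq, one_smul,
      mul_one, smul_mul_assoc, one_mul, mul_smul_comm, mul_one, sub_smul]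
    abel
  have h2 := congrArg (Rinv * ·) h
  simp only [mul_sub, mul_add, mul_one, mul_smul_comm, hRinv.2, ← mul_assoc, one_mul,
    mul_zero] at h2
  exact (sub_eq_zero.1 h2).symm

theorem heckeSystem_opAt (hRinv : R * Rinv = 1 ∧ Rinv * R = 1) (hbraid : IsBraid N R)
    (hH : R = Rinv + lam • 1) (k : ℕ) :
    HeckeSystem k lam (opAt N k (toA A R)) (opAt N k (toA A Rinv)) where
  mul_inv i := by rw [← opAt_mul, ← toA_mul, hRinv.1, toA_one, opAt_one]
  inv_mul i := by rw [← opAt_mul, ← toA_mul, hRinv.2, toA_one, opAt_one]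
  far i j h := commute_opAt_opAt (commute_toA R) h
  braid i h := by
    have hinj := shiftSite_injective i (show i + 3 ≤ k by omega)
    have e := congrArg (toA A) hbraid
    simp only [toA_mul, ← opAt_toA] at e
    have e2 := congrArg (emb (shiftSite i (show i + 3 ≤ k by omega))) e
    simpa only [emb_mul hinj, emb_shift_opAt _ _ (show 0 + 1 < 3 by omega),
      emb_shift_opAt _ _ (show 1 + 1 < 3 by omega), add_zero] using e2
  hecke i h := by
    have e : toA A R = toA A Rinv + toA A (lam • 1) := by
      nth_rewrite 1 [hH]
      exact Matrix.map_add _ (map_add _) _ _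
    have hl : opAt N k (toA A (lam • (1 : Matrix (Fin N × Fin N) (Fin N × Fin N) ℂ))) i =
        algebraMap ℂ _ lam := by
      have hi : i + 2 ≤ k := h
      rw [← emb_algebraMap (shiftSite_injective i hi), opAt_eq_emb _ hi, opAt_two]
      congr 1
      ext a b
      simp [toA, Matrix.algebraMap_matrix_apply, Matrix.one_apply, apply_ite, funext_iff,
        Fin.forall_fin_two]
      split_ifs <;> tauto
    rw [e, opAt_add h, hl]

theorem doubleSystem_matAt (hRinv : R * Rinv = 1 ∧ Rinv * R = 1) (hbraid : IsBraid N R)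
    (hH : R = Rinv + lam • 1) {M D : Matrix (Fin N) (Fin N) A} (hD : RErel N (toA A Rinv) D)
    (hDM : PermRel N R Rinv M D) (k : ℕ) :
    DoubleSystem k lam (opAt N k (toA A R)) (opAt N k (toA A Rinv)) (matAt N k M 0)
      (matAt N k D 0) where
  toHeckeSystem := heckeSystem_opAt hRinv hbraid hH k
  comm_m i h := commute_opAt_matAt (commute_toA R) M (by omega) (by omega)
  comm_d i h := commute_opAt_matAt (commute_toA R) D (by omega) (by omega)
  perm h := by
    have hinj := shiftSite_injective 0 (show 0 + 2 ≤ k by omega)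
    have e := congrArg (emb (shiftSite 0 (show 0 + 2 ≤ k by omega))) hDM
    simpa only [emb_mul hinj, emb_add, emb_shift_opAt _ _ (show 0 + 1 < 2 by omega),
      emb_shift_matAt _ _ (show 0 < 2 by omega), add_zero] using e
  refl h := by
    have hinj := shiftSite_injective 0 (show 0 + 2 ≤ k by omega)
    have e := congrArg (emb (shiftSite 0 (show 0 + 2 ≤ k by omega))) hD
    simpa only [emb_mul hinj, emb_shift_opAt _ _ (show 0 + 1 < 2 by omega),
      emb_shift_matAt _ _ (show 0 < 2 by omega), add_zero] using e

theorem commute_opAt_prod_matAt (hRinv : R * Rinv = 1 ∧ Rinv * R = 1) (hbraid : IsBraid N R)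
    (hH : R = Rinv + lam • 1) (hΨ : SkewInv N R Ψ) {i n : ℕ} (h : i + 2 ≤ n) (hn : n ≤ k) :
    Commute (opAt N k (toA A R) i) (prodSeq (matAt N k (toA A (traceMat N Ψ))) n) := by
  have hfar : ∀ j, j ≠ i → j ≠ i + 1 →
      Commute (opAt N k (toA A R) i) (matAt N k (toA A (traceMat N Ψ)) j) := fun j =>
    commute_opAt_matAt (commute_toA R) _
  induction n, h using Nat.le_induction with
  | base =>
    have hinj := shiftSite_injective i hn
    have e := congrArg (toA A) (commute_opAt_two hRinv hbraid hH hΨ).eq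
    simp only [toA_mul, ← opAt_toA, ← matAt_toA] at e
    have e2 := congrArg (emb (shiftSite i hn)) e
    simp only [emb_mul hinj, emb_shift_opAt _ _ (show 0 + 1 < 2 by omega),
      emb_shift_matAt _ _ (show 0 < 2 by omega), emb_shift_matAt _ _ (show 1 < 2 by omega),
      add_zero] at e2
    rw [prodSeq_succ, prodSeq_succ, mul_assoc]
    exact (commute_prodSeq fun j hj => hfar j (by omega) (by omega)).mul_right e2
  | succ n h ih =>
    rw [prodSeq_succ]
    exact (ih (by omega)).mul_right (hfar n (by omega) (by omega))

/-- The quantum trace is cyclic with respect to the Hecke algebra. -/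
theorem qTr_mul_comm (hRinv : R * Rinv = 1 ∧ Rinv * R = 1) (hbraid : IsBraid N R)
    (hH : R = Rinv + lam • 1) (hΨ : SkewInv N R Ψ)
    {h : Matrix (Fin k → Fin N) (Fin k → Fin N) A} (hh : h ∈ heckeSub (opAt N k (toA A R)) k)
    (x : Matrix (Fin k → Fin N) (Fin k → Fin N) A) :
    qTr N k (toA A (traceMat N Ψ)) (h * x) = qTr N k (toA A (traceMat N Ψ)) (x * h) := by
  induction hh using Algebra.adjoin_induction generalizing x with
  | mem h hh =>
    obtain ⟨i, hi, rfl⟩ := hh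
    have hc := commute_opAt_prod_matAt (A := A) hRinv hbraid hH hΨ hi le_rfl
    rw [qTr, qTr, ← prodSeq, ← mul_assoc, ← hc.eq, mul_assoc, opAt_toA, trace_toA_mul_comm, mul_assoc]
  | algebraMap c => rw [Algebra.commutes]
  | add a b _ _ ha hb => rw [add_mul, mul_add, qTr_add, qTr_add, ha, hb]
  | mul a b _ _ ha hb => rw [mul_assoc, ha, mul_assoc, hb, mul_assoc]

theorem lastQTr_mem (hRinv : R * Rinv = 1 ∧ Rinv * R = 1) (hbraid : IsBraid N R)
    (hH : R = Rinv + lam • 1) (hΨ : SkewInv N R Ψ) (hk : 1 ≤ k)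
    {x : Matrix (Fin (k + 1) → Fin N) (Fin (k + 1) → Fin N) A}
    (hx : x ∈ heckeSub (opAt N (k + 1) (toA A R)) (k + 1)) :
    lastQTr (toA A (traceMat N Ψ)) x ∈ heckeSub (opAt N k (toA A R)) k := by
  obtain ⟨n, rfl⟩ : ∃ n, k = n + 1 := ⟨k - 1, by omega⟩
  have hC := commute_toA (A := A) (traceMat N Ψ)
  have hR : lastQTr (toA A (traceMat N Ψ)) (opAt N (n + 2) (toA A R) n) = 1 := by
    refine lastQTr_opAt ?_
    rw [opAt_toA, lastQTr_toA, lastQTr_R hΨ, toA_one]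
  have h1 : lastQTr (toA A (traceMat N Ψ)) (1 : Matrix (Fin (n + 2) → Fin N) _ A) =
      algebraMap ℂ _ (traceMat N Ψ).trace := by
    rw [lastQTr_one, Matrix.algebraMap_eq_diagonal]
    congr 1
    funext i
    simp [Matrix.trace, toA]
  refine Submodule.span_induction
    (p := fun x _ => lastQTr (toA A (traceMat N Ψ)) x ∈ heckeSub (opAt N (n + 1) (toA A R)) (n + 1))
    ?_ ?_ ?_ ?_ ((heckeSystem_opAt hRinv hbraid hH (n + 2)).mem_heckeSpan (by omega) hx)
  · rintro x (hx | ⟨y, hy, z, hz, rfl⟩)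
    · obtain ⟨x, hx', rfl⟩ := exists_emb_of_mem_heckeSub le_rfl hx
      rw [← mul_one (emb _ x), lastQTr_emb_mul hC, h1]
      exact mul_mem hx' (Subalgebra.algebraMap_mem _ _)
    · obtain ⟨y, hy', rfl⟩ := exists_emb_of_mem_heckeSub le_rfl hy
      obtain ⟨z, hz', rfl⟩ := exists_emb_of_mem_heckeSub le_rfl hz
      rw [lastQTr_mul_emb, lastQTr_emb_mul hC, hR, mul_one]
      exact mul_mem hy' hz'
  · rw [lastQTr_zero]; exact zero_mem _
  · intro x y _ _ hx hy; rw [lastQTr_add]; exact add_mem hx hy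
  · intro c x _ hx; rw [lastQTr_smul]; exact Subalgebra.smul_mem _ hx c

/-- A quantum trace containing only the first `m` copies reduces to `V^{⊗m}`. -/
theorem exists_qTr_eq (hRinv : R * Rinv = 1 ∧ Rinv * R = 1) (hbraid : IsBraid N R)
    (hH : R = Rinv + lam • 1) (hΨ : SkewInv N R Ψ) (X : Matrix (Fin N) (Fin N) A) {m : ℕ}
    (hm : 1 ≤ m) (hk : m ≤ k) {h : Matrix (Fin k → Fin N) (Fin k → Fin N) A}
    (hh : h ∈ heckeSub (opAt N k (toA A R)) k) :
    ∃ h' ∈ heckeSub (opAt N m (toA A R)) m,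
      qTr N k (toA A (traceMat N Ψ)) (h * ovProd N k (toA A R) (toA A Rinv) X m) =
        qTr N m (toA A (traceMat N Ψ)) (h' * ovProd N m (toA A R) (toA A Rinv) X m) := by
  induction k, hk using Nat.le_induction with
  | base => exact ⟨h, hh, rfl⟩
  | succ k hk ih =>
    obtain ⟨h', hh', e⟩ := ih (lastQTr_mem hRinv hbraid hH hΨ (hm.trans hk) hh)
    exact ⟨h', hh', by rw [← e, qTr_succ, ← emb_ovProd _ _ X hk, lastQTr_mul_emb]⟩

end HeckeSymmetry

section Identification

variable {α : Type*} [Ring α] {N k : ℕ} (R Rinv : Matrix (Fin N × Fin N) (Fin N × Fin N) α)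

theorem ovCopy_eq_copySeq (X : Matrix (Fin N) (Fin N) α) :
    ovCopy N k R Rinv X = copySeq (opAt N k R) (opAt N k Rinv) (matAt N k X 0) := by
  funext n
  induction n with
  | zero => rfl
  | succ n ih => rw [ovCopy, ih, copySeq]

theorem JMup_zero_eq_jmInv : JMup N k Rinv 0 = jmInv (opAt N k Rinv) := by
  funext n
  induction n with
  | zero => rfl
  | succ n ih => rw [JMup, ih, jmInv, zero_add]

theorem ovProd_eq_prodSeq (X : Matrix (Fin N) (Fin N) α) (n : ℕ) :
    ovProd N k R Rinv X n =
      prodSeq (copySeq (opAt N k R) (opAt N k Rinv) (matAt N k X 0)) n := by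
  rw [ovProd, ovCopy_eq_copySeq, prodSeq]

theorem normOrd_eq (M D : Matrix (Fin N) (Fin N) α) (n : ℕ) :
    normOrd N k R Rinv M D n =
      prodSeq (copySeq (opAt N k R) (opAt N k Rinv) (matAt N k M 0)) n *
        prodSeqRev (copySeq (opAt N k R) (opAt N k Rinv) (matAt N k D 0)) n *
          prodSeq (jmInv (opAt N k Rinv)) n := by
  rw [normOrd, ovProd_eq_prodSeq, ovProdRev, ovCopy_eq_copySeq, JMup_zero_eq_jmInv]
  rfl

end Identification

section Main

variable {A : Type*} [Ring A] [Algebra ℂ A] {N k : ℕ} {lam : ℂ}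
  {R Rinv Ψ : Matrix (Fin N × Fin N) (Fin N × Fin N) ℂ}

theorem exists_qTr_eq_sum (hRinv : R * Rinv = 1 ∧ Rinv * R = 1) (hbraid : IsBraid N R)
    (hH : R = Rinv + lam • 1) (hΨ : SkewInv N R Ψ) (X : Matrix (Fin N) (Fin N) A)
    {Q x : Matrix (Fin k → Fin N) (Fin k → Fin N) A}
    (hQ : Q ∈ heckeSub (opAt N k (toA A R)) k)
    (hx : x ∈ DoubleSystem.lowerTerms (opAt N k (toA A R)) (opAt N k (toA A Rinv))
      (matAt N k X 0) k) :
    ∃ Qn : (n : ℕ) → Matrix (Fin (k - n) → Fin N) (Fin (k - n) → Fin N) A,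
      (∀ n, Qn n ∈ heckeSub (opAt N (k - n) (toA A R)) (k - n)) ∧
      qTr N k (toA A (traceMat N Ψ)) (Q * x) = ∑ n ∈ Finset.Icc 1 (k - 1),
        qTr N (k - n) (toA A (traceMat N Ψ))
          (Qn n * ovProd N (k - n) (toA A R) (toA A Rinv) X (k - n)) := by
  refine Submodule.span_induction ?_ ?_ ?_ ?_ hx
  · rintro x ⟨j, hj, hjk, h, hh, h', hh', rfl⟩
    obtain ⟨Q', hQ', e⟩ := exists_qTr_eq hRinv hbraid hH hΨ X (m := k - (k - j)) (by omega)
      (Nat.sub_le k _) (mul_mem hh' (mul_mem hQ hh))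
    refine ⟨Pi.single (k - j) Q', fun n => ?_, ?_⟩
    · rcases eq_or_ne n (k - j) with rfl | hn
      · rwa [Pi.single_eq_same]
      · rw [Pi.single_eq_of_ne hn]; exact zero_mem _
    · rw [Finset.sum_eq_single_of_mem (k - j) (Finset.mem_Icc.2 ⟨by omega, by omega⟩),
        Pi.single_eq_same, ← e, ovProd_eq_prodSeq, show k - (k - j) = j by omega, ← mul_assoc,
        ← qTr_mul_comm hRinv hbraid hH hΨ hh']
      · simp only [mul_assoc]
      · intro n _ hn
        rw [Pi.single_eq_of_ne hn, zero_mul, qTr_zero]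
  · exact ⟨0, fun n => zero_mem _, by simp [qTr_zero]⟩
  · rintro x y _ _ ⟨P, hP, eP⟩ ⟨P', hP', eP'⟩
    refine ⟨P + P', fun n => add_mem (hP n) (hP' n), ?_⟩
    simp only [mul_add, qTr_add, eP, eP', Pi.add_apply, add_mul, Finset.sum_add_distrib]
  · rintro c x _ ⟨P, hP, eP⟩
    refine ⟨c • P, fun n => Subalgebra.smul_mem _ (hP n) c, ?_⟩
    simp only [mul_smul_comm, qTr_smul, eP, Pi.smul_apply, smul_mul_assoc, Finset.smul_sum]

end Main
/-- The normally ordered form of any generalized Casimir operator is a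
finite sum of generalized Casimir operators:
`Tr_{R(1…k)}(Q · :L̂_{⟨1→k⟩}:) = Tr_{R(1…k)}(Q · L̂_{⟨1→k⟩}) + Σ_{n=1}^{k−1} Tr_{R(1…(k−n))}(Q⁽ⁿ⁾ · L̂_{⟨1→(k−n)⟩})`
with `Q⁽ⁿ⁾` in the subalgebra generated by `R₁, …, R_{k−n−1}`. -/
theorem stmt19 {A : Type*} [Ring A] [Algebra ℂ A] (N : ℕ) (hN : 1 ≤ N) (q : ℂ)
    (hq : GenericQ q)
    (R Rinv Ψ : Matrix (Fin N × Fin N) (Fin N × Fin N) ℂ)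
    (hRinv : R * Rinv = 1 ∧ Rinv * R = 1)
    (hbraid : IsBraid N R) (hHecke : IsHecke N q R)
    (hΨ : SkewInv N R Ψ)
    (M D : Matrix (Fin N) (Fin N) A)
    (hM : RErel N (toA A R) M)
    (hD : RErel N (toA A Rinv) D)
    (hDM : PermRel N R Rinv M D)
    (k : ℕ) (hk : 1 ≤ k)
    (Q : Matrix (Fin k → Fin N) (Fin k → Fin N) A)
    (hQ : Q ∈ Algebra.adjoin ℂ (genSet N k k (toA A R))) :
    ∃ Qn : (n : ℕ) → Matrix (Fin (k - n) → Fin N) (Fin (k - n) → Fin N) A,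
      (∀ n : ℕ, 1 ≤ n → n ≤ k - 1 →
        Qn n ∈ Algebra.adjoin ℂ (genSet N (k - n) (k - n) (toA A R))) ∧
      qTr N k (toA A (traceMat N Ψ)) (Q * normOrd N k (toA A R) (toA A Rinv) M D k) =
        qTr N k (toA A (traceMat N Ψ)) (Q * ovProd N k (toA A R) (toA A Rinv) (M * D) k) +
          ∑ n ∈ Finset.Icc 1 (k - 1),
            qTr N (k - n) (toA A (traceMat N Ψ))
              (Qn n * ovProd N (k - n) (toA A R) (toA A Rinv) (M * D) (k - n)) := by
  have hH := hHecke.eq_add hq.1 hRinv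
  have hl : q - q⁻¹ ≠ 0 := fun h => hq.2.2.2 2 two_pos <| by
    rw [sq]
    nth_rewrite 2 [sub_eq_zero.1 h]
    exact mul_inv_cancel₀ hq.1
  have hx := (doubleSystem_matAt hRinv hbraid hH hD hDM k).normal_sub_mem hl hk le_rfl
  rw [← normOrd_eq, ← matAt_mul hk, ← ovProd_eq_prodSeq] at hx
  obtain ⟨Qn, hQn, e⟩ := exists_qTr_eq_sum hRinv hbraid hH hΨ (M * D) hQ hx
  refine ⟨Qn, fun n _ _ => hQn n, ?_⟩
  rw [← e, ← qTr_add, ← mul_add, add_sub_cancel]
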